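/- arXiv:1103.5605 — 4 statements merged into one kernel-verified Lean document; each statement's English description precedes it below -/
import Mathlib

section
/- Suppose c = lim_{x↓0} k(x) exists in (0,∞), and define K(x) = exp(∫_x^1 (c − k(y))/y dy) and κ = exp( c·∫_0^1 (e^{−x} − 1)/x dx + c·∫_1^∞ e^{−x}/x dx − ∫_1^∞ k(x)/x dx ). Then L is absolutely continuous with a density ρ with respect to Lebesgue measure, and ρ satisfies the boundary asymptotics ρ(γ + x)·Γ(c) / ( κ·x^{c−1}·K(x) ) → 1 as x ↓ 0. -/
open MeasureTheory Filter Set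
open scoped ENNReal Topology

theorem ext_of_laplace {μ ν : Measure ℝ}
    (hμ : ∀ u > (0:ℝ), Integrable (fun x => Real.exp (-(u * x))) μ)
    (hν : ∀ u > (0:ℝ), Integrable (fun x => Real.exp (-(u * x))) ν)
    (h : ∀ u > (0:ℝ), ∫ x, Real.exp (-(u * x)) ∂μ = ∫ x, Real.exp (-(u * x)) ∂ν) :
    μ = ν := by
  have hsub : ∀ {ξ : Measure ℝ}, (∀ u > (0:ℝ), Integrable (fun x => Real.exp (-(u * x))) ξ) →
      Iio 0 ⊆ interior (ProbabilityTheory.integrableExpSet id ξ) := by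
    intro ξ hξ
    refine interior_maximal ?_ isOpen_Iio
    intro t ht
    have := hξ (-t) (by simpa using ht)
    simpa [ProbabilityTheory.integrableExpSet] using this
  have han : ∀ {ξ : Measure ℝ}, (∀ u > (0:ℝ), Integrable (fun x => Real.exp (-(u * x))) ξ) →
      AnalyticOnNhd ℂ (ProbabilityTheory.complexMGF id ξ) {z | z.re < 0} := by
    intro ξ hξ
    exact ProbabilityTheory.analyticOnNhd_complexMGF.mono fun z hz => hsub hξ hz
  have hconv : Convex ℝ {z : ℂ | z.re < 0} := convex_halfSpace_re_lt 0
  have hEq : EqOn (ProbabilityTheory.complexMGF id μ) (ProbabilityTheory.complexMGF id ν)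
      {z | z.re < 0} := by
    refine (han hμ).eqOn_of_preconnected_of_frequently_eq (han hν) hconv.isPreconnected
      (z₀ := ((-1 : ℝ) : ℂ)) (by simp) ?_
    have hreal : ∀ t : ℝ, t < 0 →
        ProbabilityTheory.complexMGF id μ t = ProbabilityTheory.complexMGF id ν t := by
      intro t ht
      rw [ProbabilityTheory.complexMGF_ofReal, ProbabilityTheory.complexMGF_ofReal]
      have := h (-t) (by linarith)
      simp only [ProbabilityTheory.mgf, id]
      simpa using this
    have ht : Tendsto (fun t : ℝ => (t : ℂ)) (𝓝[≠] (-1)) (𝓝[≠] ((-1 : ℝ) : ℂ)) := by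
      refine tendsto_nhdsWithin_iff.2 ⟨?_, ?_⟩
      · exact (Complex.continuous_ofReal.tendsto _).mono_left nhdsWithin_le_nhds
      · filter_upwards [self_mem_nhdsWithin] with t ht
        simpa [← Complex.ofReal_one, ← Complex.ofReal_neg] using ht
    refine ht.frequently (Eventually.frequently ?_)
    have : ∀ᶠ t : ℝ in 𝓝[≠] (-1), t < 0 :=
      mem_nhdsWithin_of_mem_nhds (Iio_mem_nhds (by norm_num))
    filter_upwards [this] with t ht using hreal t ht
  let e : ℝ → ℝ≥0∞ := fun x => ENNReal.ofReal (Real.exp (-x))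
  have he : Measurable e := by fun_prop
  have hfin : ∀ {ξ : Measure ℝ}, (∀ u > (0:ℝ), Integrable (fun x => Real.exp (-(u * x))) ξ) →
      IsFiniteMeasure (ξ.withDensity e) := by
    intro ξ hξ
    refine isFiniteMeasure_withDensity_ofReal ?_
    have := hξ 1 one_pos
    simp only [one_mul] at this
    exact this.2
  have hchar : ∀ {ξ : Measure ℝ} (t : ℝ),
      charFun (ξ.withDensity e) t = ProbabilityTheory.complexMGF id ξ (-1 + t * Complex.I) := by
    intro ξ t
    rw [charFun_apply_real, ProbabilityTheory.complexMGF,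
      integral_withDensity_eq_integral_toReal_smul he (by simp [e])]
    congr 1
    ext x
    simp only [e, id, ENNReal.toReal_ofReal (Real.exp_pos _).le, Complex.real_smul,
      Complex.ofReal_exp]
    rw [← Complex.exp_add]
    congr 1
    push_cast
    ring
  have := hfin hμ
  have := hfin hν
  have hkey : μ.withDensity e = ν.withDensity e := by
    refine Measure.ext_of_charFun ?_
    ext t
    rw [hchar, hchar]
    exact hEq (by simp)
  have hinv : ∀ ξ : Measure ℝ, (ξ.withDensity e).withDensity e⁻¹ = ξ := by
    intro ξ
    refine withDensity_inv_same he ?_ ?_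
    · filter_upwards with x
      simp [e, Real.exp_pos]
    · filter_upwards with x
      simp [e]
  rw [← hinv μ, ← hinv ν, hkey]

theorem integrableOn_mul_levy {k : ℝ → ℝ} (hkmeas : Measurable k)
    (hknonneg : ∀ x > (0:ℝ), 0 ≤ k x)
    (hI : IntegrableOn (fun x => min 1 x * (k x / x)) (Ioi 0))
    {f : ℝ → ℝ} (hf : Measurable f) (B : ℝ) (hB : ∀ x > 0, |f x| ≤ B * min 1 x) :
    IntegrableOn (fun x => f x * (k x / x)) (Ioi 0) := by
  refine (hI.const_mul B).mono' (by fun_prop) ?_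
  refine (ae_restrict_iff' measurableSet_Ioi).2 (ae_of_all _ fun x hx => ?_)
  have hx : 0 < x := hx
  have h2 : 0 ≤ k x / x := div_nonneg (hknonneg x hx) hx.le
  rw [Real.norm_eq_abs, abs_mul, abs_of_nonneg h2, ← mul_assoc]
  exact mul_le_mul_of_nonneg_right (hB x hx) h2

theorem abs_exp_neg_sub_one_le {t : ℝ} (ht : 0 ≤ t) : |Real.exp (-t) - 1| ≤ min 1 t := by
  have h1 : Real.exp (-t) ≤ 1 := Real.exp_le_one_iff.2 (by linarith)
  have h2 := Real.add_one_le_exp (-t)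
  have h3 := Real.exp_pos (-t)
  rw [abs_of_nonpos (by linarith)]
  exact le_min (by linarith) (by linarith)

theorem abs_exp_neg_mul_sub_one_le {u : ℝ} (hu : 0 ≤ u) {x : ℝ} (hx : 0 < x) :
    |Real.exp (-(u * x)) - 1| ≤ max 1 u * min 1 x := by
  refine (abs_exp_neg_sub_one_le (by positivity)).trans ?_
  rcases le_total 1 x with h | h
  · rw [min_eq_left h, mul_one]
    exact (min_le_left _ _).trans (le_max_left _ _)
  · rw [min_eq_right h]
    exact (min_le_right _ _).trans (by gcongr; exact le_max_right _ _)

theorem tendsto_levy_exponent_div {k : ℝ → ℝ} (hkmeas : Measurable k)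
    (hknonneg : ∀ x > (0:ℝ), 0 ≤ k x)
    (hI : IntegrableOn (fun x => min 1 x * (k x / x)) (Ioi 0)) :
    Tendsto (fun u : ℝ => (∫ x in Ioi (0:ℝ), (Real.exp (-(u * x)) - 1) * (k x / x)) / u)
      atTop (𝓝 0) := by
  have key : Tendsto (fun u : ℝ => ∫ x in Ioi (0:ℝ),
      u⁻¹ * ((Real.exp (-(u * x)) - 1) * (k x / x))) atTop
      (𝓝 (∫ x in Ioi (0:ℝ), (0:ℝ))) := by
    refine tendsto_integral_filter_of_dominated_convergence
      (fun x => min 1 x * (k x / x)) (Eventually.of_forall fun u => by fun_prop) ?_ hI ?_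
    · filter_upwards [eventually_ge_atTop 1] with u hu
      refine (ae_restrict_iff' measurableSet_Ioi).2 (ae_of_all _ fun x hx => ?_)
      have hx : 0 < x := hx
      have hu0 : 0 < u := by linarith
      have h2 : 0 ≤ k x / x := div_nonneg (hknonneg x hx) hx.le
      rw [Real.norm_eq_abs, abs_mul, abs_mul, abs_of_nonneg h2, ← mul_assoc]
      refine mul_le_mul_of_nonneg_right ?_ h2
      have := abs_exp_neg_mul_sub_one_le hu0.le hx
      rw [max_eq_right hu] at this
      rw [abs_of_pos (by positivity), inv_mul_le_iff₀ hu0]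
      exact this
    · refine (ae_restrict_iff' measurableSet_Ioi).2 (ae_of_all _ fun x hx => ?_)
      have hx : 0 < x := hx
      have h1 : Tendsto (fun u : ℝ => Real.exp (-(u * x))) atTop (𝓝 0) :=
        Real.tendsto_exp_neg_atTop_nhds_zero.comp (tendsto_id.atTop_mul_const hx)
      have := tendsto_inv_atTop_zero.mul ((h1.sub_const 1).mul_const (k x / x))
      simpa using this
  simp only [integral_zero] at key
  refine key.congr fun u => ?_
  rw [integral_const_mul, div_eq_inv_mul]

theorem hasDerivAt_levy_exponent {k : ℝ → ℝ} (hkmeas : Measurable k)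
    (hknonneg : ∀ x > (0:ℝ), 0 ≤ k x)
    (hI : IntegrableOn (fun x => min 1 x * (k x / x)) (Ioi 0)) {u : ℝ} (hu : 0 < u) :
    IntegrableOn (fun x => Real.exp (-(u * x)) * k x) (Ioi 0) ∧
    HasDerivAt (fun u : ℝ => ∫ x in Ioi (0:ℝ), (Real.exp (-(u * x)) - 1) * (k x / x))
      (-∫ x in Ioi (0:ℝ), Real.exp (-(u * x)) * k x) u := by
  have hbd : ∀ x > (0:ℝ), |x * Real.exp (-(u / 2 * x))| ≤ max 1 (2 / u) * min 1 x := by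
    intro x hx
    rw [abs_of_pos (by positivity)]
    rcases le_total 1 x with h | h
    · rw [min_eq_left h, mul_one]
      refine le_trans ?_ (le_max_right _ _)
      have := Real.add_one_le_exp (u / 2 * x)
      rw [Real.exp_neg, ← div_eq_mul_inv, div_le_div_iff₀ (Real.exp_pos _) hu]
      linarith
    · rw [min_eq_right h]
      have h1 : Real.exp (-(u / 2 * x)) ≤ 1 := Real.exp_le_one_iff.2 (by
        have : 0 < u / 2 * x := by positivity
        linarith)
      have h2 := le_max_left 1 (2 / u)
      nlinarith
  have hint := integrableOn_mul_levy hkmeas hknonneg hI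
    (f := fun x => x * Real.exp (-(u / 2 * x))) (by fun_prop) _ hbd
  have := hasDerivAt_integral_of_dominated_loc_of_deriv_le
    (μ := volume.restrict (Ioi (0:ℝ)))
    (F := fun (u x : ℝ) => (Real.exp (-(u * x)) - 1) * (k x / x))
    (F' := fun (u x : ℝ) => (Real.exp (-(u * x)) * (-x)) * (k x / x))
    (x₀ := u) (s := Ioi (u / 2)) (bound := fun x => x * Real.exp (-(u / 2 * x)) * (k x / x))
    (Ioi_mem_nhds (by linarith)) (Eventually.of_forall fun v => by fun_prop)
    (integrableOn_mul_levy hkmeas hknonneg hI (by fun_prop) _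
      fun x hx => abs_exp_neg_mul_sub_one_le hu.le hx) (by fun_prop) ?_ hint ?_
  · have heq : ∀ x ∈ Ioi (0:ℝ), (Real.exp (-(u * x)) * (-x)) * (k x / x) =
        -(Real.exp (-(u * x)) * k x) := by
      intro x hx
      have hx : x ≠ 0 := ne_of_gt hx
      field_simp
    refine ⟨?_, ?_⟩
    · have h1 := (integrableOn_congr_fun heq measurableSet_Ioi).1 this.1
      have h2 := h1.neg
      refine h2.congr (ae_of_all _ fun x => ?_)
      simp
    · have h2 := this.2
      rw [setIntegral_congr_fun measurableSet_Ioi heq, integral_neg] at h2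
      exact h2
  · refine (ae_restrict_iff' measurableSet_Ioi).2 (ae_of_all _ fun x hx => ?_)
    intro v hv
    have hx : 0 < x := hx
    have hv : u / 2 < v := hv
    have h2 : 0 ≤ k x / x := div_nonneg (hknonneg x hx) hx.le
    rw [Real.norm_eq_abs, abs_mul, abs_of_nonneg h2]
    refine mul_le_mul_of_nonneg_right ?_ h2
    rw [abs_mul, abs_neg, abs_of_pos hx, abs_of_pos (Real.exp_pos _), mul_comm]
    gcongr
  · refine (ae_restrict_iff' measurableSet_Ioi).2 (ae_of_all _ fun x hx => ?_)
    intro v hv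
    refine HasDerivAt.mul_const ?_ _
    refine HasDerivAt.sub_const _ (HasDerivAt.exp ?_)
    exact (hasDerivAt_mul_const x).fun_neg

theorem tendsto_levy_exponent {k : ℝ → ℝ} (hkmeas : Measurable k)
    (hknonneg : ∀ x > (0:ℝ), 0 ≤ k x)
    (hI : IntegrableOn (fun x => min 1 x * (k x / x)) (Ioi 0))
    {c : ℝ} (hlim : Tendsto k (𝓝[>] (0:ℝ)) (𝓝 c)) :
    Tendsto (fun u : ℝ => (∫ x in Ioi (0:ℝ), (Real.exp (-(u * x)) - 1) * (k x / x))
        + ∫ y in Ioc (1 / u) 1, k y / y) atTop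
      (𝓝 (c * (∫ x in Set.Ioc (0:ℝ) 1, (Real.exp (-x) - 1) / x)
        + c * (∫ x in Set.Ioi (1:ℝ), Real.exp (-x) / x)
        - ∫ x in Set.Ioi (1:ℝ), k x / x)) := by
  set w : ℝ → ℝ := fun s => Real.exp (-s) - indicator (Iic 1) (fun _ => (1:ℝ)) s with hw
  have hwm : Measurable w := by
    refine Measurable.sub (by fun_prop) (measurable_const.indicator measurableSet_Iic)
  have hw1 : ∀ s ≤ 1, w s = Real.exp (-s) - 1 := by
    intro s hs; simp [hw, hs]
  have hw2 : ∀ s, 1 < s → w s = Real.exp (-s) := by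
    intro s hs; simp [hw, hs]
  have hwb : ∀ s > 0, |w s / s| ≤ Real.exp 1 * Real.exp (-s) := by
    intro s hs
    rw [abs_div, abs_of_pos hs, div_le_iff₀ hs, ← Real.exp_add]
    rcases le_or_gt s 1 with h | h
    · rw [hw1 s h]
      have h1 := (abs_exp_neg_sub_one_le hs.le).trans (min_le_right _ _)
      have h2 : 1 ≤ Real.exp (1 + -s) := Real.one_le_exp (by linarith)
      nlinarith
    · rw [hw2 s h, abs_of_pos (Real.exp_pos _)]
      have h2 : Real.exp (-s) ≤ Real.exp (1 + -s) := Real.exp_le_exp.2 (by linarith)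
      have := Real.exp_pos (1 + -s)
      nlinarith
  have hexpint : IntegrableOn (fun s : ℝ => Real.exp 1 * Real.exp (-s)) (Ioi 0) :=
    (integrableOn_exp_neg_Ioi 0).const_mul _
  have hwint : IntegrableOn (fun s => w s / s) (Ioi 0) := by
    refine hexpint.mono' (hwm.div measurable_id).aestronglyMeasurable ?_
    exact (ae_restrict_iff' measurableSet_Ioi).2 (ae_of_all _ fun x hx => hwb x hx)
  have hlimint : ∫ s in Ioi (0:ℝ), w s / s * c =
      c * (∫ x in Set.Ioc (0:ℝ) 1, (Real.exp (-x) - 1) / x)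
        + c * (∫ x in Set.Ioi (1:ℝ), Real.exp (-x) / x) := by
    rw [integral_mul_const, mul_comm, ← mul_add, ← Ioc_union_Ioi_eq_Ioi zero_le_one,
      setIntegral_union (Ioc_disjoint_Ioi le_rfl) measurableSet_Ioi
        (hwint.mono_set Ioc_subset_Ioi_self) (hwint.mono_set (Ioi_subset_Ioi zero_le_one))]
    congr 2
    · refine setIntegral_congr_fun measurableSet_Ioc fun x hx => ?_
      simp only [hw1 x hx.2]
    · refine setIntegral_congr_fun measurableSet_Ioi fun x hx => ?_
      simp only [hw2 x hx]
  obtain ⟨δ, hδ, hδ1, hδk⟩ : ∃ δ > 0, δ ≤ 1 ∧ ∀ x, 0 < x → x ≤ δ → k x ≤ |c| + 1 := by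
    have h1 : ∀ᶠ x in 𝓝[>] (0:ℝ), k x < |c| + 1 :=
      hlim.eventually_lt_const ((le_abs_self c).trans_lt (by linarith))
    obtain ⟨δ, hδ, h⟩ := mem_nhdsGT_iff_exists_Ioc_subset.1 h1
    refine ⟨min δ 1, lt_min hδ one_pos, min_le_right _ _, fun x hx hxd => ?_⟩
    exact le_of_lt (h ⟨hx, hxd.trans (min_le_left _ _)⟩)
  have htail : ∀ a > 0, IntegrableOn (fun x => k x / x) (Ioi a) := by
    intro a ha
    refine ((hI.mono_set (Ioi_subset_Ioi ha.le)).const_mul (min 1 a)⁻¹).mono'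
      (hkmeas.div measurable_id).aestronglyMeasurable ?_
    refine (ae_restrict_iff' measurableSet_Ioi).2 (ae_of_all _ fun x hx => ?_)
    have hx : a < x := hx
    have hx0 : 0 < x := ha.trans hx
    have h2 : 0 ≤ k x / x := div_nonneg (hknonneg x hx0) hx0.le
    rw [Real.norm_eq_abs, abs_of_nonneg h2, ← mul_assoc]
    refine le_mul_of_one_le_left h2 ?_
    rw [inv_mul_eq_div, one_le_div (by positivity)]
    exact min_le_min le_rfl hx.le
  have hwuint : ∀ u > 0, IntegrableOn (fun x => w (u * x) * (k x / x)) (Ioi 0) := by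
    intro u hu
    refine integrableOn_mul_levy hkmeas hknonneg hI (by fun_prop)
      (max (u * Real.exp 1) (2 * Real.exp 1)) ?_
    intro x hx
    have h1 := hwb (u * x) (by positivity)
    rw [abs_div, abs_of_pos (by positivity : 0 < u * x), div_le_iff₀ (by positivity)] at h1
    refine h1.trans ?_
    rcases le_total 1 x with h | h
    · rw [min_eq_left h, mul_one]
      refine le_trans ?_ (le_max_right _ _)
      have h3 := Real.add_one_le_exp (u * x)
      have h4 : Real.exp (-(u * x)) * (u * x) ≤ 1 := by
        rw [Real.exp_neg, inv_mul_le_iff₀ (Real.exp_pos _)]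
        linarith
      have := Real.exp_pos 1
      nlinarith
    · rw [min_eq_right h]
      have h4 : Real.exp (-(u * x)) ≤ 1 := Real.exp_le_one_iff.2 (by
        have : 0 < u * x := by positivity
        linarith)
      calc Real.exp 1 * Real.exp (-(u * x)) * (u * x) ≤ Real.exp 1 * 1 * (u * x) := by gcongr
        _ = u * Real.exp 1 * x := by ring
        _ ≤ _ := by gcongr; exact le_max_left _ _
  have hsplit : ∀ u ≥ 1, (∫ x in Ioi (0:ℝ), (Real.exp (-(u * x)) - 1) * (k x / x))
        + ∫ y in Ioc (1 / u) 1, k y / y =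
      (∫ x in Ioi (0:ℝ), w (u * x) * (k x / x)) - ∫ x in Ioi (1:ℝ), k x / x := by
    intro u hu
    have hu0 : 0 < u := by linarith
    have hu1 : 0 < 1 / u := by positivity
    have hu2 : 1 / u ≤ 1 := by rw [div_le_one hu0]; exact hu
    have h1 : ∫ x in Ioi (1 / u), k x / x =
        (∫ y in Ioc (1 / u) 1, k y / y) + ∫ x in Ioi (1:ℝ), k x / x := by
      rw [← Ioc_union_Ioi_eq_Ioi hu2, setIntegral_union (Ioc_disjoint_Ioi le_rfl)
        measurableSet_Ioi ((htail _ hu1).mono_set Ioc_subset_Ioi_self) (htail 1 one_pos)]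
    have h2 : ∫ x in Ioi (1 / u), k x / x =
        ∫ x in Ioi (0:ℝ), indicator (Ioi (1 / u)) (fun x => k x / x) x := by
      rw [setIntegral_indicator measurableSet_Ioi, inter_eq_self_of_subset_right
        (Ioi_subset_Ioi hu1.le)]
    have h3 : ∫ x in Ioi (0:ℝ), w (u * x) * (k x / x) =
        (∫ x in Ioi (0:ℝ), (Real.exp (-(u * x)) - 1) * (k x / x)) +
        ∫ x in Ioi (0:ℝ), indicator (Ioi (1 / u)) (fun x => k x / x) x := by
      rw [← integral_add]
      · refine setIntegral_congr_fun measurableSet_Ioi fun x hx => ?_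
        by_cases hxu : 1 / u < x
        · have : 1 < u * x := by rwa [div_lt_iff₀' hu0] at hxu
          simp only [hw2 _ this]
          rw [indicator_of_mem (by exact hxu)]
          ring
        · have : u * x ≤ 1 := by rwa [not_lt, le_div_iff₀' hu0] at hxu
          simp only [hw1 _ this]
          rw [indicator_of_notMem (by exact hxu)]
          ring
      · exact integrableOn_mul_levy hkmeas hknonneg hI (by fun_prop) _
          fun x hx => abs_exp_neg_mul_sub_one_le hu0.le hx
      · have : IntegrableOn (indicator (Ioi (1 / u)) (fun x => k x / x)) univ := by
          rw [integrableOn_univ, integrable_indicator_iff measurableSet_Ioi]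
          exact htail _ hu1
        exact this.mono_set (subset_univ _)
    linarith
  have hnear : Tendsto (fun u : ℝ => ∫ x in Ioc 0 δ, w (u * x) * (k x / x)) atTop
      (𝓝 (∫ s in Ioi (0:ℝ), w s / s * c)) := by
    have hrw : ∀ u > 0, ∫ x in Ioc 0 δ, w (u * x) * (k x / x) =
        ∫ s in Ioi (0:ℝ), w s / s * indicator (Iic δ) k (s / u) := by
      intro u hu
      have h1 := integral_comp_mul_left_Ioi
        (fun s => w s / s * indicator (Iic δ) k (s / u)) 0 hu
      rw [mul_zero] at h1
      have h2 : ∫ x in Ioc 0 δ, w (u * x) * (k x / x) =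
          ∫ x in Ioi (0:ℝ), indicator (Iic δ) (fun x => w (u * x) * (k x / x)) x := by
        rw [setIntegral_indicator measurableSet_Iic, Ioi_inter_Iic]
      rw [h2, ← mul_right_inj' (inv_ne_zero hu.ne'), ← smul_eq_mul (a := u⁻¹),
        ← smul_eq_mul (a := u⁻¹), ← h1, ← integral_smul]
      refine setIntegral_congr_fun measurableSet_Ioi fun x hx => ?_
      have hx : 0 < x := hx
      have h3 : u * x / u = x := by field_simp
      simp only [h3, smul_eq_mul]
      by_cases hxd : x ≤ δ
      · rw [indicator_of_mem (by exact hxd), indicator_of_mem (by exact hxd)]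
        field_simp
      · rw [indicator_of_notMem (by exact hxd), indicator_of_notMem (by exact hxd)]
        ring
    have key : Tendsto (fun u : ℝ => ∫ s in Ioi (0:ℝ), w s / s * indicator (Iic δ) k (s / u))
        atTop (𝓝 (∫ s in Ioi (0:ℝ), w s / s * c)) := by
      have hkm : Measurable (indicator (Iic δ) k) := hkmeas.indicator measurableSet_Iic
      refine tendsto_integral_filter_of_dominated_convergence
        (fun s => Real.exp 1 * Real.exp (-s) * (|c| + 1))
        (Eventually.of_forall fun u => by fun_prop) ?_ (hexpint.mul_const _) ?_
      · filter_upwards [eventually_gt_atTop 0] with u hu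
        refine (ae_restrict_iff' measurableSet_Ioi).2 (ae_of_all _ fun x hx => ?_)
        have hx : 0 < x := hx
        rw [norm_mul]
        refine mul_le_mul (hwb x hx) ?_ (norm_nonneg _) (by positivity)
        by_cases hxd : x / u ≤ δ
        · rw [indicator_of_mem (by exact hxd), Real.norm_eq_abs,
            abs_of_nonneg (hknonneg _ (by positivity))]
          exact hδk _ (by positivity) hxd
        · rw [indicator_of_notMem (by exact hxd), norm_zero]
          positivity
      · refine (ae_restrict_iff' measurableSet_Ioi).2 (ae_of_all _ fun x hx => ?_)
        have hx : 0 < x := hx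
        refine Tendsto.const_mul _ ?_
        have h1 : Tendsto (fun u : ℝ => x / u) atTop (𝓝[>] 0) := by
          refine tendsto_nhdsWithin_iff.2 ⟨tendsto_const_nhds.div_atTop tendsto_id, ?_⟩
          filter_upwards [eventually_gt_atTop 0] with u hu
          exact div_pos hx hu
        have h2 : Tendsto (indicator (Iic δ) k) (𝓝[>] 0) (𝓝 c) := by
          refine hlim.congr' ?_
          have : ∀ᶠ y in 𝓝[>] (0:ℝ), y ≤ δ := mem_nhdsWithin_of_mem_nhds (Iic_mem_nhds hδ)
          filter_upwards [this] with y hy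
          rw [indicator_of_mem (by exact hy)]
        exact h2.comp h1
    refine key.congr' ?_
    filter_upwards [eventually_gt_atTop 0] with u hu using (hrw u hu).symm
  have hfar : Tendsto (fun u : ℝ => ∫ x in Ioi δ, w (u * x) * (k x / x)) atTop (𝓝 0) := by
    have key : Tendsto (fun u : ℝ => ∫ x in Ioi δ, w (u * x) * (k x / x)) atTop
        (𝓝 (∫ x in Ioi δ, (0:ℝ))) := by
      have hlarge : ∀ u > 1 / δ, ∀ x > δ, w (u * x) = Real.exp (-(u * x)) := by
        intro u hu x hx
        refine hw2 _ ?_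
        rw [gt_iff_lt, div_lt_iff₀ hδ] at hu
        have : 0 < u := by nlinarith
        nlinarith
      refine tendsto_integral_filter_of_dominated_convergence
        (fun x => k x / x) (Eventually.of_forall fun u => by fun_prop) ?_ (htail δ hδ) ?_
      · filter_upwards [eventually_gt_atTop (1 / δ), eventually_gt_atTop 0] with u hu hu0
        refine (ae_restrict_iff' measurableSet_Ioi).2 (ae_of_all _ fun x hx => ?_)
        have hx : δ < x := hx
        have hx0 : 0 < x := hδ.trans hx
        have h2 : 0 ≤ k x / x := div_nonneg (hknonneg x hx0) hx0.le
        rw [hlarge u hu x hx, norm_mul, Real.norm_eq_abs, Real.norm_eq_abs, abs_of_nonneg h2,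
          abs_of_pos (Real.exp_pos _)]
        refine mul_le_of_le_one_left h2 (Real.exp_le_one_iff.2 ?_)
        have : 0 < u * x := by positivity
        linarith
      · refine (ae_restrict_iff' measurableSet_Ioi).2 (ae_of_all _ fun x hx => ?_)
        have hx : δ < x := hx
        have h1 : Tendsto (fun u : ℝ => Real.exp (-(u * x))) atTop (𝓝 0) :=
          Real.tendsto_exp_neg_atTop_nhds_zero.comp (tendsto_id.atTop_mul_const (hδ.trans hx))
        have h2 := h1.mul_const (k x / x)
        rw [zero_mul] at h2
        refine h2.congr' ?_
        filter_upwards [eventually_gt_atTop (1 / δ)] with u hu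
        rw [hlarge u hu x hx]
    simpa using key
  rw [← hlimint]
  have hfinal := (hnear.add hfar).sub_const (∫ x in Ioi (1:ℝ), k x / x)
  rw [add_zero] at hfinal
  refine hfinal.congr' ?_
  filter_upwards [eventually_ge_atTop 1] with u hu
  have hu0 : 0 < u := by linarith
  rw [hsplit u hu]
  congr 1
  rw [← Ioc_union_Ioi_eq_Ioi hδ.le, setIntegral_union (Ioc_disjoint_Ioi le_rfl)
    measurableSet_Ioi ((hwuint u hu0).mono_set Ioc_subset_Ioi_self)
    ((hwuint u hu0).mono_set (Ioi_subset_Ioi hδ.le))]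
theorem ext_of_lintegral_laplace {μ ν : Measure ℝ}
    (hμ : ∀ u > (0:ℝ), ∫⁻ x, ENNReal.ofReal (Real.exp (-(u * x))) ∂μ ≠ ⊤)
    (h : ∀ u > (0:ℝ), ∫⁻ x, ENNReal.ofReal (Real.exp (-(u * x))) ∂μ =
      ∫⁻ x, ENNReal.ofReal (Real.exp (-(u * x))) ∂ν) :
    μ = ν := by
  have hint : ∀ {ξ : Measure ℝ} {u : ℝ}, ∫⁻ x, ENNReal.ofReal (Real.exp (-(u * x))) ∂ξ ≠ ⊤ →
      Integrable (fun x => Real.exp (-(u * x))) ξ := by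
    intro ξ u hξ
    refine ⟨by fun_prop, ?_⟩
    rw [hasFiniteIntegral_iff_ofReal (ae_of_all _ fun x => (Real.exp_pos _).le)]
    exact hξ.lt_top
  refine ext_of_laplace (fun u hu => hint (hμ u hu)) (fun u hu => hint (h u hu ▸ hμ u hu)) ?_
  intro u hu
  rw [integral_eq_lintegral_of_nonneg_ae (ae_of_all _ fun x => (Real.exp_pos _).le)
    (by fun_prop), integral_eq_lintegral_of_nonneg_ae (ae_of_all _ fun x => (Real.exp_pos _).le)
    (by fun_prop), h u hu]

/-- The density `k` extended by zero to `(-∞, 0]`, with values in `ℝ≥0∞`. -/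
noncomputable def jumpDensity (k : ℝ → ℝ) : ℝ → ℝ≥0∞ :=
  indicator (Ioi 0) fun x => ENNReal.ofReal (k x)

/-- The density of the convolution of `M` with the measure of density `k` on `(0, ∞)`. -/
noncomputable def sizeBiasDensity (k : ℝ → ℝ) (M : Measure ℝ) (z : ℝ) : ℝ≥0∞ :=
  ∫⁻ x, jumpDensity k (z - x) ∂M

theorem measurable_jumpDensity {k : ℝ → ℝ} (hkmeas : Measurable k) :
    Measurable (jumpDensity k) :=
  hkmeas.ennreal_ofReal.indicator measurableSet_Ioi

theorem measurable_sizeBiasDensity {k : ℝ → ℝ} (hkmeas : Measurable k) (M : Measure ℝ)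
    [SFinite M] : Measurable (sizeBiasDensity k M) := by
  have := measurable_jumpDensity hkmeas
  unfold sizeBiasDensity
  exact Measurable.lintegral_prod_right (by fun_prop)

theorem conv_jumpDensity {k : ℝ → ℝ} (hkmeas : Measurable k) (M : Measure ℝ) [SFinite M] :
    M ∗ (volume.withDensity (jumpDensity k)) = volume.withDensity (sizeBiasDensity k M) := by
  have hn := measurable_jumpDensity hkmeas
  refine Measure.ext_of_lintegral _ fun f hf => ?_
  rw [Measure.lintegral_conv hf,
    lintegral_withDensity_eq_lintegral_mul _ (measurable_sizeBiasDensity hkmeas M) hf]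
  simp only [Pi.mul_apply, sizeBiasDensity]
  calc ∫⁻ x, ∫⁻ y, f (x + y) ∂(volume.withDensity (jumpDensity k)) ∂M
      = ∫⁻ x, (∫⁻ z, jumpDensity k (z - x) * f z) ∂M := by
        refine lintegral_congr fun x => ?_
        rw [lintegral_withDensity_eq_lintegral_mul _ hn (by fun_prop),
          ← lintegral_sub_right_eq_self _ x]
        simp
    _ = ∫⁻ z, ∫⁻ x, jumpDensity k (z - x) * f z ∂M := lintegral_lintegral_swap (by fun_prop)
    _ = _ := by
        refine lintegral_congr fun z => ?_
        rw [lintegral_mul_const _ (by fun_prop)]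

section Levy

variable {k : ℝ → ℝ} {M : Measure ℝ}

theorem integrable_exp_of_laplace
    (hLap : ∀ u ≥ (0:ℝ), ∫ x, Real.exp (-(u * x)) ∂M
        = Real.exp (∫ x in Ioi (0:ℝ), (Real.exp (-(u * x)) - 1) * (k x / x)))
    {u : ℝ} (hu : 0 ≤ u) : Integrable (fun x => Real.exp (-(u * x))) M := by
  refine Integrable.of_integral_ne_zero ?_
  rw [hLap u hu]
  exact (Real.exp_pos _).ne'

theorem withDensity_id_eq [IsProbabilityMeasure M] (hkmeas : Measurable k)
    (hknonneg : ∀ x > (0:ℝ), 0 ≤ k x)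
    (hI : IntegrableOn (fun x => min 1 x * (k x / x)) (Ioi 0))
    (hM : M (Iio 0) = 0)
    (hLap : ∀ u ≥ (0:ℝ), ∫ x, Real.exp (-(u * x)) ∂M
        = Real.exp (∫ x in Ioi (0:ℝ), (Real.exp (-(u * x)) - 1) * (k x / x))) :
    M.withDensity ENNReal.ofReal = volume.withDensity (sizeBiasDensity k M) := by
  have hn := measurable_jumpDensity hkmeas
  have hMae : ∀ᵐ x ∂M, 0 ≤ x := by
    rw [ae_iff]
    simpa [Iio] using hM
  have hleft : ∀ u > (0:ℝ), ∫⁻ x, ENNReal.ofReal (Real.exp (-(u * x))) ∂(M.withDensity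
      ENNReal.ofReal) = ENNReal.ofReal (Real.exp
        (∫ x in Ioi (0:ℝ), (Real.exp (-(u * x)) - 1) * (k x / x)) *
        ∫ x in Ioi (0:ℝ), Real.exp (-(u * x)) * k x) := by
    intro u hu
    rw [lintegral_withDensity_eq_lintegral_mul _ (by fun_prop) (by fun_prop)]
    have hmem : -u ∈ interior (ProbabilityTheory.integrableExpSet id M) := by
      have : Iio 0 ⊆ interior (ProbabilityTheory.integrableExpSet id M) := by
        refine interior_maximal (fun t ht => ?_) isOpen_Iio
        have ht : t < 0 := ht
        have := integrable_exp_of_laplace hLap (u := -t) (by linarith)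
        simpa [ProbabilityTheory.integrableExpSet] using this
      exact this (by simpa using hu)
    have hd := (ProbabilityTheory.hasDerivAt_mgf hmem).comp u (hasDerivAt_neg u)
    have hd2 := (hasDerivAt_levy_exponent hkmeas hknonneg hI hu).2.exp
    have heq : (ProbabilityTheory.mgf id M ∘ fun u => -u) =ᶠ[𝓝 u] fun u =>
        Real.exp (∫ x in Ioi (0:ℝ), (Real.exp (-(u * x)) - 1) * (k x / x)) := by
      filter_upwards [Ioi_mem_nhds hu] with v hv
      rw [← hLap v (le_of_lt hv)]
      simp [ProbabilityTheory.mgf]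
    have huniq := (hd.congr_of_eventuallyEq heq.symm).unique hd2
    have hint : Integrable (fun x => x * Real.exp (-(u * x))) M := by
      have := ProbabilityTheory.integrable_pow_mul_exp_of_mem_interior_integrableExpSet hmem 1
      simpa using this
    rw [show Real.exp (∫ x in Ioi (0:ℝ), (Real.exp (-(u * x)) - 1) * (k x / x)) *
        ∫ x in Ioi (0:ℝ), Real.exp (-(u * x)) * k x = ∫ x, x * Real.exp (-(u * x)) ∂M by
      simp only [id, neg_mul] at huniq
      linarith, ofReal_integral_eq_lintegral_ofReal hint]
    · refine lintegral_congr_ae ?_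
      filter_upwards [hMae] with x hx
      rw [Pi.mul_apply, ENNReal.ofReal_mul hx]
    · filter_upwards [hMae] with x hx
      exact mul_nonneg hx (Real.exp_pos _).le
  have hright : ∀ u > (0:ℝ), ∫⁻ x, ENNReal.ofReal (Real.exp (-(u * x)))
      ∂(M ∗ (volume.withDensity (jumpDensity k))) = ENNReal.ofReal (Real.exp
        (∫ x in Ioi (0:ℝ), (Real.exp (-(u * x)) - 1) * (k x / x)) *
        ∫ x in Ioi (0:ℝ), Real.exp (-(u * x)) * k x) := by
    intro u hu
    have hN : ∫⁻ y, ENNReal.ofReal (Real.exp (-(u * y))) ∂(volume.withDensity (jumpDensity k)) =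
        ENNReal.ofReal (∫ x in Ioi (0:ℝ), Real.exp (-(u * x)) * k x) := by
      rw [lintegral_withDensity_eq_lintegral_mul _ hn (by fun_prop),
        ofReal_integral_eq_lintegral_ofReal (hasDerivAt_levy_exponent hkmeas hknonneg hI hu).1,
        ← lintegral_indicator measurableSet_Ioi]
      · refine lintegral_congr fun x => ?_
        by_cases hx : x ∈ Ioi (0:ℝ)
        · simp only [Pi.mul_apply, jumpDensity, indicator_of_mem hx]
          rw [ENNReal.ofReal_mul (Real.exp_pos _).le, mul_comm]
        · simp [Pi.mul_apply, jumpDensity, indicator_of_notMem hx]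
      · refine (ae_restrict_iff' measurableSet_Ioi).2 (ae_of_all _ fun x hx => ?_)
        exact mul_nonneg (Real.exp_pos _).le (hknonneg x hx)
    rw [Measure.lintegral_conv (by fun_prop), ENNReal.ofReal_mul (Real.exp_pos _).le, ← hN,
      ← hLap u hu.le, ofReal_integral_eq_lintegral_ofReal
        (integrable_exp_of_laplace hLap hu.le) (ae_of_all _ fun x => (Real.exp_pos _).le),
      ← lintegral_mul_const _ (by fun_prop)]
    refine lintegral_congr fun x => ?_
    rw [← lintegral_const_mul _ (by fun_prop)]
    refine lintegral_congr fun y => ?_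
    rw [← ENNReal.ofReal_mul (Real.exp_pos _).le, ← Real.exp_add]
    ring_nf
  rw [← conv_jumpDensity hkmeas M]
  refine ext_of_lintegral_laplace (fun u hu => ?_) fun u hu => ?_
  · rw [hleft u hu]
    exact ENNReal.ofReal_ne_top
  · rw [hleft u hu, hright u hu]

theorem sizeBiasDensity_le {p δ : ℝ} (hM : M (Iio 0) = 0)
    (hk : ∀ x, 0 < x → x ≤ δ → k x ≤ p) {z : ℝ} (hz : z ≤ δ) :
    sizeBiasDensity k M z ≤ ENNReal.ofReal p * M (Iio z) := by
  have hMae : ∀ᵐ x ∂M, 0 ≤ x := by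
    rw [ae_iff]
    simpa [Iio] using hM
  rw [← lintegral_indicator_const measurableSet_Iio]
  refine lintegral_mono_ae ?_
  filter_upwards [hMae] with x hx
  by_cases hxz : x < z
  · rw [indicator_of_mem (by exact hxz), jumpDensity, indicator_of_mem (by simpa using hxz)]
    exact ENNReal.ofReal_le_ofReal (hk _ (by linarith) (by linarith))
  · rw [jumpDensity, indicator_of_notMem (by simpa using hxz)]
    exact zero_le

theorem le_sizeBiasDensity {q δ : ℝ} (hM : M (Iio 0) = 0)
    (hk : ∀ x, 0 < x → x ≤ δ → q ≤ k x) {z : ℝ} (hz : z ≤ δ) :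
    ENNReal.ofReal q * M (Iio z) ≤ sizeBiasDensity k M z := by
  have hMae : ∀ᵐ x ∂M, 0 ≤ x := by
    rw [ae_iff]
    simpa [Iio] using hM
  rw [← lintegral_indicator_const measurableSet_Iio]
  refine lintegral_mono_ae ?_
  filter_upwards [hMae] with x hx
  by_cases hxz : x < z
  · rw [indicator_of_mem (by exact hxz), jumpDensity, indicator_of_mem (by simpa using hxz)]
    exact ENNReal.ofReal_le_ofReal (hk _ (by linarith) (by linarith))
  · rw [indicator_of_notMem (by exact hxz)]
    exact zero_le

theorem restrict_Ioi_eq_withDensity [IsProbabilityMeasure M] (hkmeas : Measurable k)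
    (h : M.withDensity ENNReal.ofReal = volume.withDensity (sizeBiasDensity k M)) :
    M.restrict (Ioi 0) =
      volume.withDensity fun z => sizeBiasDensity k M z * (ENNReal.ofReal z)⁻¹ := by
  have hg := measurable_sizeBiasDensity hkmeas M
  have h1 : (M.withDensity ENNReal.ofReal).withDensity (fun z => (ENNReal.ofReal z)⁻¹) =
      M.restrict (Ioi 0) := by
    rw [← withDensity_mul _ (by fun_prop) (by fun_prop),
      ← withDensity_indicator_one measurableSet_Ioi]
    congr 1
    ext x
    by_cases hx : 0 < x
    · rw [indicator_of_mem (by exact hx), Pi.mul_apply,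
        ENNReal.mul_inv_cancel (by simpa using hx) ENNReal.ofReal_ne_top, Pi.one_apply]
    · rw [indicator_of_notMem (by exact hx), Pi.mul_apply,
        ENNReal.ofReal_of_nonpos (not_lt.1 hx), zero_mul]
  rw [← h1, h, ← withDensity_mul _ hg (by fun_prop)]
  rfl

theorem measure_zero_eq_zero [IsProbabilityMeasure M] (hkmeas : Measurable k)
    (h : M.withDensity ENNReal.ofReal = volume.withDensity (sizeBiasDensity k M))
    (hM : M (Iio 0) = 0)
    {c : ℝ} (hc : 0 < c) (hlim : Tendsto k (𝓝[>] (0:ℝ)) (𝓝 c)) : M {0} = 0 := by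
  have hr := restrict_Ioi_eq_withDensity hkmeas h
  by_contra hne
  have h1 : ∀ᶠ x in 𝓝[>] (0:ℝ), c / 2 < k x := hlim.eventually_const_lt (by linarith)
  obtain ⟨δ, hδ, hδk⟩ := mem_nhdsGT_iff_exists_Ioc_subset.1 h1
  have hδ : 0 < δ := hδ
  have hfin : ∫⁻ z, sizeBiasDensity k M z * (ENNReal.ofReal z)⁻¹ ≠ ⊤ := by
    rw [← setLIntegral_univ, ← withDensity_apply _ MeasurableSet.univ, ← hr]
    exact measure_ne_top _ _
  have hC0 : ENNReal.ofReal (c / 2) * M {0} ≠ 0 := mul_ne_zero (by simpa using hc) hne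
  have hCt : ENNReal.ofReal (c / 2) * M {0} ≠ ⊤ :=
    ENNReal.mul_ne_top ENNReal.ofReal_ne_top (measure_ne_top _ _)
  have hle : (ENNReal.ofReal (c / 2) * M {0}) * ∫⁻ z in Ioc 0 δ, (ENNReal.ofReal z)⁻¹ ≤
      ∫⁻ z, sizeBiasDensity k M z * (ENNReal.ofReal z)⁻¹ := by
    rw [← lintegral_const_mul' _ _ hCt]
    refine le_trans ?_ (setLIntegral_le_lintegral (Ioc 0 δ) _)
    refine setLIntegral_mono' measurableSet_Ioc fun z hz => ?_
    gcongr
    refine le_trans ?_ (le_sizeBiasDensity (q := c / 2) (δ := δ) hM ?_ hz.2)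
    · gcongr
      simpa using hz.1
    · exact fun x hx hxd => le_of_lt (hδk ⟨hx, hxd⟩)
  have hfin2 : ∫⁻ z in Ioc 0 δ, (ENNReal.ofReal z)⁻¹ ≠ ⊤ := by
    intro htop
    rw [htop, ENNReal.mul_top hC0] at hle
    exact hfin (top_le_iff.1 hle)
  have hint : IntervalIntegrable (fun x : ℝ => x⁻¹) volume 0 δ := by
    rw [intervalIntegrable_iff_integrableOn_Ioc_of_le hδ.le]
    refine ⟨by fun_prop, ?_⟩
    rw [hasFiniteIntegral_iff_ofReal]
    · rw [setLIntegral_congr_fun measurableSet_Ioc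
        (fun z hz => ENNReal.ofReal_inv_of_pos hz.1)]
      exact hfin2.lt_top
    · refine (ae_restrict_iff' measurableSet_Ioc).2 (ae_of_all _ fun x hx => ?_)
      exact inv_nonneg.2 hx.1.le
  rw [intervalIntegrable_inv_iff] at hint
  rcases hint with h | h
  · linarith
  · exact h (by simp)

theorem eq_withDensity [IsProbabilityMeasure M] (hkmeas : Measurable k)
    (h : M.withDensity ENNReal.ofReal = volume.withDensity (sizeBiasDensity k M))
    (hM : M (Iio 0) = 0)
    {c : ℝ} (hc : 0 < c) (hlim : Tendsto k (𝓝[>] (0:ℝ)) (𝓝 c)) :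
    M = volume.withDensity fun z => sizeBiasDensity k M z * (ENNReal.ofReal z)⁻¹ := by
  rw [← restrict_Ioi_eq_withDensity hkmeas h]
  refine (Measure.restrict_eq_self_of_ae_mem ?_).symm
  rw [ae_iff]
  have : {a : ℝ | a ∉ Ioi (0:ℝ)} = Iio 0 ∪ {0} := by
    ext x
    simp [le_iff_lt_or_eq]
  rw [this]
  exact measure_union_null hM (measure_zero_eq_zero hkmeas h hM hc hlim)

end Levy
/-- A discrete Grönwall inequality: a multiplicative growth bound `w h ≈ 1 + r h` over short steps
gives exponential growth at rate `r`. -/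
theorem mul_exp_le_of_step {Φ w : ℝ → ℝ} {τ r : ℝ} (hτ : 0 ≤ τ)
    (hstep : ∀ s h, 0 ≤ s → 0 ≤ h → s + h ≤ τ → Φ s * w h ≤ Φ (s + h))
    (hw0 : w 0 = 1) (hw : HasDerivAt w r 0) : Φ 0 * Real.exp (r * τ) ≤ Φ τ := by
  rcases hτ.eq_or_lt with rfl | hτ
  · simp
  have hseq : Tendsto (fun n : ℕ => τ / n) atTop (𝓝[≠] 0) := by
    refine tendsto_nhdsWithin_iff.2 ⟨tendsto_const_div_atTop_nhds_zero_nat τ, ?_⟩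
    filter_upwards [eventually_gt_atTop 0] with n hn
    have : (0:ℝ) < n := by exact_mod_cast hn
    exact (div_pos hτ this).ne'
  have hlim : Tendsto (fun n : ℕ => (n : ℝ) * (w (τ / n) - 1)) atTop (𝓝 (r * τ)) := by
    have h1 := (hw.tendsto_slope_zero.comp hseq).mul_const τ
    refine h1.congr' ?_
    filter_upwards [eventually_gt_atTop 0] with n hn
    have : (0:ℝ) < n := by exact_mod_cast hn
    simp only [Function.comp_apply, zero_add, hw0, smul_eq_mul]
    field_simp
  have hexp := Real.tendsto_one_add_pow_exp_of_tendsto hlim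
  have hpos : ∀ᶠ n : ℕ in atTop, 0 < w (τ / n) := by
    have h1 : Tendsto (fun n : ℕ => w (τ / n)) atTop (𝓝 (w 0)) :=
      hw.continuousAt.tendsto.comp (hseq.mono_right nhdsWithin_le_nhds)
    rw [hw0] at h1
    exact h1.eventually_const_lt one_pos
  refine le_of_tendsto (hexp.const_mul (Φ 0)) ?_
  filter_upwards [hpos, eventually_gt_atTop 0] with n hwn hn
  have hn' : (0:ℝ) < n := by exact_mod_cast hn
  rw [add_sub_cancel]
  have hind : ∀ i : ℕ, i ≤ n → Φ 0 * w (τ / n) ^ i ≤ Φ (i * (τ / n)) := by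
    intro i
    induction i with
    | zero => intro _; simp
    | succ i ih =>
      intro hi
      have hi' : ((i + 1 : ℕ) : ℝ) ≤ n := by exact_mod_cast hi
      have h1 := hstep (i * (τ / n)) (τ / n) (by positivity) (by positivity) (by
        calc (i : ℝ) * (τ / n) + τ / n = ((i + 1 : ℕ) : ℝ) * (τ / n) := by push_cast; ring
          _ ≤ n * (τ / n) := by gcongr
          _ = τ := by field_simp)
      calc Φ 0 * w (τ / n) ^ (i + 1) = (Φ 0 * w (τ / n) ^ i) * w (τ / n) := by ring
        _ ≤ Φ (i * (τ / n)) * w (τ / n) := by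
          gcongr
          exact ih (by omega)
        _ ≤ _ := h1
        _ = _ := by push_cast; ring_nf
  have := hind n le_rfl
  rwa [mul_div_cancel₀ _ hn'.ne'] at this

theorem le_mul_rpow_of_sub_le {F : ℝ → ℝ} {p δ : ℝ}
    (h : ∀ a b, 0 < a → a ≤ b → b ≤ δ → F b - F a ≤ p * F b / a * (b - a))
    {a b : ℝ} (ha : 0 < a) (hab : a ≤ b) (hb : b ≤ δ) : F b ≤ F a * (b / a) ^ p := by
  have hb0 : 0 < b := ha.trans_le hab
  have hτ : 0 ≤ Real.log (b / a) := Real.log_nonneg ((one_le_div ha).2 hab)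
  have key := mul_exp_le_of_step (Φ := fun t => F (b * Real.exp (-t)))
    (w := fun h => 1 - p * (Real.exp h - 1)) (r := -p) hτ ?_ (by simp) ?_
  · simp only [neg_zero, Real.exp_zero, mul_one] at key
    rw [Real.exp_neg, Real.exp_log (by positivity)] at key
    rw [Real.rpow_def_of_pos (by positivity)]
    rw [show b * (b / a)⁻¹ = a by field_simp, neg_mul, Real.exp_neg, ← div_eq_mul_inv,
      div_le_iff₀ (Real.exp_pos _), mul_comm p] at key
    exact key
  · intro s t hs ht hst
    have h1 : a ≤ b * Real.exp (-(s + t)) := by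
      have : Real.exp (s + t) ≤ b / a := by
        rw [← Real.exp_log (show 0 < b / a by positivity)]
        exact Real.exp_le_exp.2 hst
      rw [Real.exp_neg, ← div_eq_mul_inv, le_div_iff₀ (Real.exp_pos _)]
      rw [le_div_iff₀ ha] at this
      linarith
    have h2 := h (b * Real.exp (-(s + t))) (b * Real.exp (-s)) (by positivity)
      (by gcongr; linarith) ((mul_le_of_le_one_right hb0.le
        (Real.exp_le_one_iff.2 (by linarith))).trans hb)
    have h3 : p * F (b * Real.exp (-s)) / (b * Real.exp (-(s + t))) *
        (b * Real.exp (-s) - b * Real.exp (-(s + t))) =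
        p * F (b * Real.exp (-s)) * (Real.exp t - 1) := by
      have : Real.exp (-s) = Real.exp (-(s + t)) * Real.exp t := by
        rw [← Real.exp_add]; ring_nf
      rw [div_mul_eq_mul_div, div_eq_iff (by positivity)]
      rw [show b * Real.exp (-s) - b * Real.exp (-(s + t)) =
        (Real.exp t - 1) * (b * Real.exp (-(s + t))) by rw [this]; ring]
      ring
    rw [h3] at h2
    linarith
  · have := (((Real.hasDerivAt_exp 0).sub_const 1).const_mul p).const_sub 1
    simpa using this

theorem mul_rpow_le_of_le_sub {F : ℝ → ℝ} {q δ : ℝ}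
    (h : ∀ a b, 0 < a → a ≤ b → b ≤ δ → q * F a / b * (b - a) ≤ F b - F a)
    {a b : ℝ} (ha : 0 < a) (hab : a ≤ b) (hb : b ≤ δ) : F a * (b / a) ^ q ≤ F b := by
  have hb0 : 0 < b := ha.trans_le hab
  have hτ : 0 ≤ Real.log (b / a) := Real.log_nonneg ((one_le_div ha).2 hab)
  have key := mul_exp_le_of_step (Φ := fun t => F (a * Real.exp t))
    (w := fun h => 1 + q * (1 - Real.exp (-h))) (r := q) hτ ?_ (by simp) ?_
  · simp only [Real.exp_zero, mul_one] at key
    rw [Real.exp_log (by positivity), mul_div_cancel₀ _ ha.ne'] at key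
    rw [Real.rpow_def_of_pos (by positivity), mul_comm _ q]
    exact key
  · intro s t hs ht hst
    have h1 : a * Real.exp (s + t) ≤ b := by
      have : Real.exp (s + t) ≤ b / a := by
        rw [← Real.exp_log (show 0 < b / a by positivity)]
        exact Real.exp_le_exp.2 hst
      rw [le_div_iff₀ ha] at this
      linarith
    have h2 := h (a * Real.exp s) (a * Real.exp (s + t)) (by positivity)
      (by gcongr; linarith) (h1.trans hb)
    have h3 : q * F (a * Real.exp s) / (a * Real.exp (s + t)) *
        (a * Real.exp (s + t) - a * Real.exp s) =
        q * F (a * Real.exp s) * (1 - Real.exp (-t)) := by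
      have : Real.exp s = Real.exp (s + t) * Real.exp (-t) := by
        rw [← Real.exp_add]; ring_nf
      rw [div_mul_eq_mul_div, div_eq_iff (by positivity)]
      rw [show a * Real.exp (s + t) - a * Real.exp s =
        (1 - Real.exp (-t)) * (a * Real.exp (s + t)) by
          rw [mul_comm (1 - Real.exp (-t)), mul_assoc, mul_one_sub, ← this]; ring]
      ring
    rw [h3] at h2
    linarith
  · have := (((hasDerivAt_neg (0:ℝ)).exp.const_sub 1).const_mul q).const_add 1
    simpa using this

theorem tendsto_ratio_of_bounds {F : ℝ → ℝ} {c : ℝ} (hpos : ∀ x > 0, 0 < F x)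
    (hbd : ∀ ε > 0, ∃ δ > 0, ∀ a b, 0 < a → a ≤ b → b ≤ δ →
      F a * (b / a) ^ (c - ε) ≤ F b ∧ F b ≤ F a * (b / a) ^ (c + ε))
    {s : ℝ} (hs : 0 < s) :
    Tendsto (fun x => F (s * x) / F x) (𝓝[>] 0) (𝓝 (s ^ c)) := by
  have main : ∀ s : ℝ, 1 ≤ s → Tendsto (fun x => F (s * x) / F x) (𝓝[>] 0) (𝓝 (s ^ c)) := by
    intro s hs
    have hs0 : 0 < s := by linarith
    have hcont : Continuous fun e : ℝ => s ^ (c + e) :=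
      Continuous.rpow continuous_const (by fun_prop) fun _ => Or.inl hs0.ne'
    have hcont0 : Tendsto (fun e : ℝ => s ^ (c + e)) (𝓝 0) (𝓝 (s ^ c)) := by
      simpa using hcont.tendsto 0
    have hcont1 : Tendsto (fun e : ℝ => s ^ (c - e)) (𝓝 0) (𝓝 (s ^ c)) := by
      have := hcont0.comp (show Tendsto (fun e : ℝ => -e) (𝓝 0) (𝓝 0) by
        simpa using (continuous_neg (G := ℝ)).tendsto 0)
      simpa [Function.comp_def, ← sub_eq_add_neg] using this
    have hev : ∀ ε > 0, ∀ᶠ x in 𝓝[>] (0:ℝ),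
        s ^ (c - ε) ≤ F (s * x) / F x ∧ F (s * x) / F x ≤ s ^ (c + ε) := by
      intro ε hε
      obtain ⟨δ, hδ, h⟩ := hbd ε hε
      have h1 : ∀ᶠ x in 𝓝[>] (0:ℝ), x ≤ δ / s :=
        mem_nhdsWithin_of_mem_nhds (Iic_mem_nhds (by positivity))
      filter_upwards [h1, self_mem_nhdsWithin] with x hx hx0
      have hx0 : 0 < x := hx0
      rw [le_div_iff₀' hs0] at hx
      have h2 := h x (s * x) hx0 (by nlinarith) hx
      rw [mul_div_cancel_right₀ _ hx0.ne'] at h2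
      have hFx := hpos x hx0
      rw [le_div_iff₀' hFx, div_le_iff₀' hFx]
      exact h2
    refine tendsto_order.2 ⟨fun a ha => ?_, fun a ha => ?_⟩
    · have h1 := (hcont1.mono_left (nhdsWithin_le_nhds (s := Ioi 0))).eventually_const_lt ha
      obtain ⟨ε, hε, hε0⟩ := (h1.and self_mem_nhdsWithin).exists
      filter_upwards [hev ε hε0] with x hx using hε.trans_le hx.1
    · have h1 := (hcont0.mono_left (nhdsWithin_le_nhds (s := Ioi 0))).eventually_lt_const ha
      obtain ⟨ε, hε, hε0⟩ := (h1.and self_mem_nhdsWithin).exists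
      filter_upwards [hev ε hε0] with x hx using hx.2.trans_lt hε
  rcases le_total 1 s with h | h
  · exact main s h
  · have h1 := main s⁻¹ ((one_le_inv₀ hs).2 h)
    have h2 : Tendsto (fun x => s * x) (𝓝[>] (0:ℝ)) (𝓝[>] 0) := by
      refine tendsto_nhdsWithin_iff.2 ⟨?_, ?_⟩
      · have : Tendsto (fun x : ℝ => s * x) (𝓝 0) (𝓝 0) := by
          simpa using (continuous_const_mul s).tendsto 0
        exact this.mono_left nhdsWithin_le_nhds
      · filter_upwards [self_mem_nhdsWithin] with x hx
        exact mul_pos hs hx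
    have h3 := (h1.comp h2).inv₀ (by positivity)
    rw [Real.inv_rpow hs.le, inv_inv] at h3
    refine h3.congr fun x => ?_
    simp only [Function.comp_apply, inv_mul_cancel_left₀ hs.ne', inv_div]

/-- Dominated convergence for the Laplace transform of a regularly varying function. -/
theorem tendsto_integral_exp_mul_ratio {F : ℝ → ℝ} {c : ℝ} (hc : 0 < c) (hmono : Monotone F)
    (hle : ∀ x, F x ≤ 1) (hpos : ∀ x > 0, 0 < F x)
    (hbd : ∀ ε > 0, ∃ δ > 0, ∀ a b, 0 < a → a ≤ b → b ≤ δ →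
      F a * (b / a) ^ (c - ε) ≤ F b ∧ F b ≤ F a * (b / a) ^ (c + ε)) :
    Tendsto (fun x => ∫ s in Ioi (0:ℝ), Real.exp (-s) * (F (s * x) / F x)) (𝓝[>] 0)
      (𝓝 (Real.Gamma (c + 1))) := by
  obtain ⟨δ, hδ, h⟩ := hbd 1 one_pos
  have hFm := hmono.measurable
  have hFδ := hpos δ hδ
  rw [Real.Gamma_eq_integral (by linarith)]
  refine tendsto_integral_filter_of_dominated_convergence
    (fun s => (F δ)⁻¹ * (Real.exp (-s) + Real.exp (-s) * s ^ (c + 1)))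
    (Eventually.of_forall fun u => by fun_prop) ?_ ?_ ?_
  · have h1 : ∀ᶠ x in 𝓝[>] (0:ℝ), x ≤ δ := mem_nhdsWithin_of_mem_nhds (Iic_mem_nhds hδ)
    filter_upwards [h1, self_mem_nhdsWithin] with x hxδ hx0
    have hx0 : 0 < x := hx0
    have hFx := hpos x hx0
    refine (ae_restrict_iff' measurableSet_Ioi).2 (ae_of_all _ fun s hs => ?_)
    have hs : 0 < s := hs
    have hsp : 0 < s ^ (c + 1) := by positivity
    have hinv : 1 ≤ (F δ)⁻¹ := (one_le_inv₀ hFδ).2 (hle δ)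
    rw [Real.norm_eq_abs, abs_of_nonneg (mul_nonneg (Real.exp_pos _).le
      (div_nonneg (hpos _ (by positivity)).le hFx.le)),
      show (F δ)⁻¹ * (Real.exp (-s) + Real.exp (-s) * s ^ (c + 1)) =
        Real.exp (-s) * ((F δ)⁻¹ * (1 + s ^ (c + 1))) by ring]
    gcongr
    rcases le_total s 1 with hs1 | hs1
    · have h2 : F (s * x) / F x ≤ 1 := (div_le_one hFx).2 (hmono (by nlinarith))
      nlinarith
    · suffices F (s * x) / F x ≤ (F δ)⁻¹ * s ^ (c + 1) by nlinarith
      rcases le_total (s * x) δ with hsx | hsx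
      · have h2 := (h x (s * x) hx0 (by nlinarith) hsx).2
        rw [mul_div_cancel_right₀ _ hx0.ne', ← div_le_iff₀' hFx] at h2
        nlinarith
      · have h2 := (h x δ hx0 hxδ le_rfl).2
        have h3 : (δ / x) ^ (c + 1) ≤ s ^ (c + 1) :=
          Real.rpow_le_rpow (by positivity) ((div_le_iff₀ hx0).2 hsx) (by linarith)
        rw [div_le_iff₀ hFx, inv_mul_eq_div, div_mul_eq_mul_div, le_div_iff₀ hFδ]
        have h4 := hle (s * x)
        have h5 := hpos (s * x) (by positivity)
        calc F (s * x) * F δ ≤ 1 * F δ := by gcongr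
          _ ≤ F x * (δ / x) ^ (c + 1) := by rw [one_mul]; exact h2
          _ ≤ F x * s ^ (c + 1) := by gcongr
          _ = _ := mul_comm _ _
  · refine Integrable.const_mul ((integrableOn_exp_neg_Ioi 0).add ?_) _
    have := Real.GammaIntegral_convergent (s := c + 2) (by linarith)
    rwa [show c + 2 - 1 = c + 1 by ring] at this
  · refine (ae_restrict_iff' measurableSet_Ioi).2 (ae_of_all _ fun s hs => ?_)
    have := (tendsto_ratio_of_bounds hpos hbd hs).const_mul (Real.exp (-s))
    simpa using this

theorem integral_exp_eq_integral_measure_Iio {M : Measure ℝ} [IsProbabilityMeasure M]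
    (hM : M (Iio 0) = 0) {x : ℝ} (hx : 0 < x) :
    ∫ y, Real.exp (-(1 / x * y)) ∂M =
      ∫ s in Ioi (0:ℝ), Real.exp (-s) * M.real (Iio (s * x)) := by
  have hMae : ∀ᵐ x ∂M, 0 ≤ x := by
    rw [ae_iff]
    simpa [Iio] using hM
  have hmono : Monotone fun z => M.real (Iio z) := fun a b hab =>
    measureReal_mono (Iio_subset_Iio hab)
  have hmeas : Measurable fun s => M.real (Iio (s * x)) :=
    hmono.measurable.comp (measurable_id.mul_const x)
  rw [integral_eq_lintegral_of_nonneg_ae (ae_of_all _ fun x => (Real.exp_pos _).le)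
    (by fun_prop), integral_eq_lintegral_of_nonneg_ae
    (ae_of_all _ fun x => mul_nonneg (Real.exp_pos _).le measureReal_nonneg)
    (by fun_prop)]
  congr 1
  have hset : MeasurableSet {p : ℝ × ℝ | p.2 < p.1 * x} :=
    measurableSet_lt measurable_snd (by fun_prop)
  calc ∫⁻ y, ENNReal.ofReal (Real.exp (-(1 / x * y))) ∂M
      = ∫⁻ y, (∫⁻ s in Ioi (0:ℝ), indicator {p : ℝ × ℝ | p.2 < p.1 * x}
          (fun p => ENNReal.ofReal (Real.exp (-p.1))) (s, y)) ∂M := by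
        refine lintegral_congr_ae ?_
        filter_upwards [hMae] with y hy
        have h1 : ∀ s, indicator {p : ℝ × ℝ | p.2 < p.1 * x}
            (fun p => ENNReal.ofReal (Real.exp (-p.1))) (s, y) =
            indicator (Ioi (1 / x * y)) (fun s => ENNReal.ofReal (Real.exp (-s))) s := by
          intro s
          have : y < s * x ↔ 1 / x * y < s := by
            rw [one_div, inv_mul_lt_iff₀ hx, mul_comm]
          by_cases h : y < s * x
          · rw [indicator_of_mem (by exact h), indicator_of_mem (by exact this.1 h)]
          · rw [indicator_of_notMem (by exact h),
              indicator_of_notMem (by exact fun h' => h (this.2 h'))]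
        simp only [h1]
        rw [lintegral_indicator measurableSet_Ioi, Measure.restrict_restrict measurableSet_Ioi,
          inter_eq_self_of_subset_left (Ioi_subset_Ioi (by positivity)),
          ← ofReal_integral_eq_lintegral_ofReal (integrableOn_exp_neg_Ioi _)
            (ae_of_all _ fun x => (Real.exp_pos _).le), integral_exp_neg_Ioi]
    _ = ∫⁻ s in Ioi (0:ℝ), (∫⁻ y, indicator {p : ℝ × ℝ | p.2 < p.1 * x}
          (fun p => ENNReal.ofReal (Real.exp (-p.1))) (s, y) ∂M) := by
        refine lintegral_lintegral_swap (Measurable.aemeasurable ?_)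
        have hm : Measurable (indicator {p : ℝ × ℝ | p.2 < p.1 * x}
          (fun p => ENNReal.ofReal (Real.exp (-p.1)))) :=
          Measurable.indicator (by fun_prop) hset
        exact hm.comp measurable_swap
    _ = _ := by
        refine lintegral_congr fun s => ?_
        rw [ENNReal.ofReal_mul (Real.exp_pos _).le, ofReal_measureReal,
          ← lintegral_indicator_const measurableSet_Iio]
        refine lintegral_congr fun y => ?_
        simp [indicator]

theorem exists_forall_mem_Icc_of_tendsto {k : ℝ → ℝ} {c : ℝ}
    (hlim : Tendsto k (𝓝[>] (0:ℝ)) (𝓝 c)) {ε : ℝ} (hε : 0 < ε) :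
    ∃ δ > 0, ∀ x, 0 < x → x ≤ δ → c - ε ≤ k x ∧ k x ≤ c + ε := by
  have h1 := (hlim.eventually_const_le (show c - ε < c by linarith)).and
    (hlim.eventually_le_const (show c < c + ε by linarith))
  obtain ⟨δ, hδ, h⟩ := mem_nhdsGT_iff_exists_Ioc_subset.1 h1
  exact ⟨δ, hδ, fun x hx hxd => h ⟨hx, hxd⟩⟩

theorem measureReal_Iio_pos {k : ℝ → ℝ} {M : Measure ℝ} [IsProbabilityMeasure M]
    (hkmeas : Measurable k) (hknonneg : ∀ x > (0:ℝ), 0 ≤ k x)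
    (hI : IntegrableOn (fun x => min 1 x * (k x / x)) (Ioi 0))
    (hLap : ∀ u ≥ (0:ℝ), ∫ x, Real.exp (-(u * x)) ∂M
        = Real.exp (∫ x in Ioi (0:ℝ), (Real.exp (-(u * x)) - 1) * (k x / x)))
    {x : ℝ} (hx : 0 < x) : 0 < M.real (Iio x) := by
  by_contra hneg
  have h0 : M (Iio x) = 0 := by
    rw [← measureReal_eq_zero_iff]
    exact le_antisymm (not_lt.1 hneg) measureReal_nonneg
  have hae : ∀ᵐ y ∂M, x ≤ y := by
    rw [ae_iff]
    simpa [Iio] using h0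
  have hle : ∀ u > (0:ℝ),
      (∫ x in Ioi (0:ℝ), (Real.exp (-(u * x)) - 1) * (k x / x)) / u ≤ -x := by
    intro u hu
    have h1 : ∫ y, Real.exp (-(u * y)) ∂M ≤ ∫ _, Real.exp (-(u * x)) ∂M := by
      refine integral_mono_ae (integrable_exp_of_laplace hLap hu.le) (integrable_const _) ?_
      filter_upwards [hae] with y hy
      exact Real.exp_le_exp.2 (by nlinarith)
    rw [hLap u hu.le, integral_const, probReal_univ, one_smul, Real.exp_le_exp] at h1
    rw [div_le_iff₀ hu]
    linarith
  have := le_of_tendsto (tendsto_levy_exponent_div hkmeas hknonneg hI)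
    (by filter_upwards [eventually_gt_atTop 0] with u hu using hle u hu)
  linarith

section Increments

variable {k : ℝ → ℝ} {M : Measure ℝ} [IsProbabilityMeasure M]

theorem measureReal_Iio_sub {a b : ℝ} (hab : a ≤ b) :
    M.real (Iio b) - M.real (Iio a) = M.real (Ico a b) := by
  rw [← Iio_union_Ico_eq_Iio hab, measureReal_union _ measurableSet_Ico]
  · ring
  · exact disjoint_left.2 fun x hx hx' => not_lt.2 hx'.1 hx

theorem measureReal_Iio_sub_le
    (hdens : M = volume.withDensity fun z => sizeBiasDensity k M z * (ENNReal.ofReal z)⁻¹)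
    (hM : M (Iio 0) = 0) {p δ : ℝ} (hp : 0 ≤ p) (hk : ∀ x, 0 < x → x ≤ δ → k x ≤ p)
    {a b : ℝ} (ha : 0 < a) (hab : a ≤ b) (hb : b ≤ δ) :
    M.real (Iio b) - M.real (Iio a) ≤ p * M.real (Iio b) / a * (b - a) := by
  have hF : 0 ≤ M.real (Iio b) := measureReal_nonneg
  have hC : 0 ≤ p * M.real (Iio b) / a := by positivity
  rw [measureReal_Iio_sub hab, Measure.real]
  refine ENNReal.toReal_le_of_le_ofReal (mul_nonneg hC (by linarith)) ?_
  rw [ENNReal.ofReal_mul hC, ← Real.volume_Ico, ← setLIntegral_const]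
  conv_lhs => rw [hdens, withDensity_apply _ measurableSet_Ico]
  refine setLIntegral_mono' measurableSet_Ico fun z hz => ?_
  rw [ENNReal.ofReal_div_of_pos ha, ENNReal.ofReal_mul hp, ofReal_measureReal,
    ENNReal.div_eq_inv_mul, mul_comm]
  gcongr
  · exact hz.1
  · refine (sizeBiasDensity_le hM hk (hz.2.le.trans hb)).trans ?_
    gcongr
    exact hz.2.le

theorem le_measureReal_Iio_sub
    (hdens : M = volume.withDensity fun z => sizeBiasDensity k M z * (ENNReal.ofReal z)⁻¹)
    (hM : M (Iio 0) = 0) {q δ : ℝ} (hq : 0 ≤ q) (hk : ∀ x, 0 < x → x ≤ δ → q ≤ k x)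
    {a b : ℝ} (ha : 0 < a) (hab : a ≤ b) (hb : b ≤ δ) :
    q * M.real (Iio a) / b * (b - a) ≤ M.real (Iio b) - M.real (Iio a) := by
  have hb0 : 0 < b := ha.trans_le hab
  have hF : 0 ≤ M.real (Iio a) := measureReal_nonneg
  have hC : 0 ≤ q * M.real (Iio a) / b := by positivity
  rw [measureReal_Iio_sub hab]
  refine (ENNReal.ofReal_le_iff_le_toReal (measure_ne_top _ _)).1 ?_
  rw [ENNReal.ofReal_mul hC, ← Real.volume_Ico, ← setLIntegral_const]
  conv_rhs => rw [hdens, withDensity_apply _ measurableSet_Ico]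
  refine setLIntegral_mono' measurableSet_Ico fun z hz => ?_
  rw [ENNReal.ofReal_div_of_pos hb0, ENNReal.ofReal_mul hq, ofReal_measureReal,
    ENNReal.div_eq_inv_mul, mul_comm]
  gcongr
  · refine le_trans ?_ (le_sizeBiasDensity hM hk (hz.2.le.trans hb))
    gcongr
    exact hz.1
  · exact hz.2.le

theorem measureReal_Iio_bounds
    (hdens : M = volume.withDensity fun z => sizeBiasDensity k M z * (ENNReal.ofReal z)⁻¹)
    (hM : M (Iio 0) = 0) {c : ℝ} (hc : 0 < c) (hlim : Tendsto k (𝓝[>] (0:ℝ)) (𝓝 c))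
    {ε : ℝ} (hε : 0 < ε) : ∃ δ > 0, ∀ a b, 0 < a → a ≤ b → b ≤ δ →
      M.real (Iio a) * (b / a) ^ (c - ε) ≤ M.real (Iio b) ∧
      M.real (Iio b) ≤ M.real (Iio a) * (b / a) ^ (c + ε) := by
  have hη : 0 < min ε c := lt_min hε hc
  obtain ⟨δ, hδ, h⟩ := exists_forall_mem_Icc_of_tendsto hlim hη
  refine ⟨δ, hδ, fun a b ha hab hb => ⟨?_, ?_⟩⟩
  · refine le_trans ?_ (mul_rpow_le_of_le_sub (F := fun x => M.real (Iio x)) (δ := δ)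
      (q := c - min ε c) (fun a b ha hab hb => le_measureReal_Iio_sub hdens hM
        (sub_nonneg.2 (min_le_right _ _)) (fun x hx hxd => (h x hx hxd).1) ha hab hb) ha hab hb)
    have := min_le_left ε c
    gcongr
    exact (one_le_div ha).2 hab
  · refine le_trans (le_mul_rpow_of_sub_le (F := fun x => M.real (Iio x)) (δ := δ)
      (p := c + min ε c) (fun a b ha hab hb => measureReal_Iio_sub_le hdens hM
        (by positivity) (fun x hx hxd => (h x hx hxd).2) ha hab hb) ha hab hb) ?_
    have := min_le_left ε c
    gcongr
    exact (one_le_div ha).2 hab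

theorem tendsto_sizeBiasDensity_div (hM : M (Iio 0) = 0)
    {c : ℝ} (hc : 0 < c) (hlim : Tendsto k (𝓝[>] (0:ℝ)) (𝓝 c))
    (hpos : ∀ x > 0, 0 < M.real (Iio x)) :
    Tendsto (fun x => (sizeBiasDensity k M x).toReal / M.real (Iio x)) (𝓝[>] 0) (𝓝 c) := by
  rw [Metric.tendsto_nhds]
  intro ε hε
  obtain ⟨δ, hδ, h⟩ := exists_forall_mem_Icc_of_tendsto hlim
    (show 0 < min (ε / 2) c by positivity)
  have h1 : ∀ᶠ x in 𝓝[>] (0:ℝ), x ≤ δ := mem_nhdsWithin_of_mem_nhds (Iic_mem_nhds hδ)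
  filter_upwards [h1, self_mem_nhdsWithin] with x hxδ hx0
  have hF := hpos x hx0
  have hu := sizeBiasDensity_le hM (fun x hx hxd => (h x hx hxd).2) hxδ
  have hl := le_sizeBiasDensity hM (fun x hx hxd => (h x hx hxd).1) hxδ
  have hutop : ENNReal.ofReal (c + min (ε / 2) c) * M (Iio x) ≠ ⊤ :=
    ENNReal.mul_ne_top ENNReal.ofReal_ne_top (measure_ne_top _ _)
  have hu' := ENNReal.toReal_mono hutop hu
  have hl' := ENNReal.toReal_mono (ne_top_of_le_ne_top hutop hu) hl
  rw [ENNReal.toReal_mul, ENNReal.toReal_ofReal (by positivity)] at hu'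
  rw [ENNReal.toReal_mul, ENNReal.toReal_ofReal (sub_nonneg.2 (min_le_right _ _))] at hl'
  change _ ≤ _ * M.real (Iio x) at hu'
  change _ * M.real (Iio x) ≤ _ at hl'
  have hm := min_le_left (ε / 2) c
  rw [Real.dist_eq, abs_lt]
  constructor
  · rw [lt_sub_iff_add_lt, lt_div_iff₀ hF]
    nlinarith
  · rw [sub_lt_iff_lt_add, div_lt_iff₀ hF]
    nlinarith

end Increments

theorem setIntegral_Ioc_const_sub_div {k : ℝ → ℝ} (hkmeas : Measurable k)
    (hI : IntegrableOn (fun x => min 1 x * (k x / x)) (Ioi 0)) (c : ℝ)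
    {x : ℝ} (hx : 0 < x) (hx1 : x ≤ 1) :
    ∫ y in Ioc x 1, (c - k y) / y = -(c * Real.log x) - ∫ y in Ioc x 1, k y / y := by
  have hinv : IntegrableOn (fun y : ℝ => c * y⁻¹) (Ioc x 1) := by
    refine Integrable.const_mul ?_ _
    have : IntervalIntegrable (fun y : ℝ => y⁻¹) volume x 1 := by
      rw [intervalIntegrable_inv_iff]
      right
      rw [uIcc_of_le hx1]
      exact fun h => not_le.2 hx h.1
    exact (intervalIntegrable_iff_integrableOn_Ioc_of_le hx1).1 this
  have hk : IntegrableOn (fun y => k y / y) (Ioc x 1) := by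
    refine ((hI.mono_set (t := Ioi 0) (s := Ioc x 1) fun y hy => hx.trans hy.1).norm.const_mul
      x⁻¹).mono' (hkmeas.div measurable_id).aestronglyMeasurable ?_
    refine (ae_restrict_iff' measurableSet_Ioc).2 (ae_of_all _ fun y hy => ?_)
    have hy0 : 0 < y := hx.trans hy.1
    rw [min_eq_right hy.2, norm_mul, ← mul_assoc, Real.norm_eq_abs y, abs_of_pos hy0]
    refine le_mul_of_one_le_left (norm_nonneg _) ?_
    rw [inv_mul_eq_div, one_le_div hx]
    exact hy.1.le
  have hlog : ∫ y in Ioc x 1, c * y⁻¹ = -(c * Real.log x) := by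
    rw [integral_const_mul, ← intervalIntegral.integral_of_le hx1,
      integral_inv_of_pos hx one_pos, one_div, Real.log_inv]
    ring
  rw [← hlog, ← integral_sub hinv hk]
  refine integral_congr_ae (ae_of_all _ fun y => ?_)
  simp only
  rw [sub_div, div_eq_mul_inv c]

theorem tendsto_density_of_laplace {k : ℝ → ℝ} {M : Measure ℝ} [IsProbabilityMeasure M]
    (hkmeas : Measurable k) (hknonneg : ∀ x > (0:ℝ), 0 ≤ k x)
    (hI : IntegrableOn (fun x => min 1 x * (k x / x)) (Ioi 0))
    (hM : M (Iio 0) = 0)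
    (hLap : ∀ u ≥ (0:ℝ), ∫ x, Real.exp (-(u * x)) ∂M
        = Real.exp (∫ x in Ioi (0:ℝ), (Real.exp (-(u * x)) - 1) * (k x / x)))
    {c : ℝ} (hc : 0 < c) (hlim : Tendsto k (𝓝[>] (0:ℝ)) (𝓝 c))
    (hdens : M = volume.withDensity fun z => sizeBiasDensity k M z * (ENNReal.ofReal z)⁻¹) :
    Tendsto (fun x => (sizeBiasDensity k M x * (ENNReal.ofReal x)⁻¹).toReal * Real.Gamma c /
        (Real.exp (c * (∫ x in Set.Ioc (0:ℝ) 1, (Real.exp (-x) - 1) / x)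
          + c * (∫ x in Set.Ioi (1:ℝ), Real.exp (-x) / x)
          - ∫ x in Set.Ioi (1:ℝ), k x / x) * x ^ (c - 1) *
          Real.exp (∫ y in Set.Ioc x 1, (c - k y) / y)))
      (𝓝[>] (0:ℝ)) (𝓝 1) := by
  set ℓ := c * (∫ x in Set.Ioc (0:ℝ) 1, (Real.exp (-x) - 1) / x)
          + c * (∫ x in Set.Ioi (1:ℝ), Real.exp (-x) / x)
          - ∫ x in Set.Ioi (1:ℝ), k x / x with hℓ
  have hpos : ∀ x > 0, 0 < M.real (Iio x) := fun x hx =>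
    measureReal_Iio_pos hkmeas hknonneg hI hLap hx
  have hratio := tendsto_sizeBiasDensity_div hM hc hlim hpos
  have hGpos : 0 < Real.Gamma (c + 1) := Real.Gamma_pos_of_pos (by linarith)
  have habel : Tendsto (fun x => M.real (Iio x) / ∫ y, Real.exp (-(1 / x * y)) ∂M) (𝓝[>] 0)
      (𝓝 (Real.Gamma (c + 1))⁻¹) := by
    have h1 := (tendsto_integral_exp_mul_ratio (F := fun x => M.real (Iio x)) hc
      (fun a b hab => measureReal_mono (Iio_subset_Iio hab)) (fun x => measureReal_le_one) hpos
      (fun ε hε => measureReal_Iio_bounds hdens hM hc hlim hε)).inv₀ hGpos.ne'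
    refine h1.congr' ?_
    filter_upwards [self_mem_nhdsWithin] with x hx
    rw [integral_exp_eq_integral_measure_Iio hM hx]
    simp only [← mul_div_assoc]
    rw [integral_div, inv_div]
  have hphi : Tendsto (fun x => (∫ y, Real.exp (-(1 / x * y)) ∂M) /
      (Real.exp ℓ * x ^ c * Real.exp (∫ y in Set.Ioc x 1, (c - k y) / y))) (𝓝[>] 0) (𝓝 1) := by
    have h1 := (((tendsto_levy_exponent hkmeas hknonneg hI hlim).comp
      tendsto_inv_nhdsGT_zero).sub_const ℓ).rexp
    rw [← hℓ, sub_self, Real.exp_zero] at h1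
    refine h1.congr' ?_
    have h2 : ∀ᶠ x in 𝓝[>] (0:ℝ), x ≤ 1 := mem_nhdsWithin_of_mem_nhds (Iic_mem_nhds one_pos)
    filter_upwards [self_mem_nhdsWithin, h2] with x hx hx1
    have hx : 0 < x := hx
    rw [hLap _ (by positivity), setIntegral_Ioc_const_sub_div hkmeas hI c hx hx1,
      Real.rpow_def_of_pos hx, ← Real.exp_add, ← Real.exp_add, ← Real.exp_sub]
    simp only [Function.comp_apply, one_div, inv_inv]
    congr 1
    ring
  have hall := ((hratio.mul habel).mul hphi).mul_const (Real.Gamma c)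
  have hone : c * (Real.Gamma (c + 1))⁻¹ * 1 * Real.Gamma c = 1 := by
    have := (Real.Gamma_pos_of_pos hc).ne'
    rw [Real.Gamma_add_one hc.ne']
    field_simp
  rw [hone] at hall
  refine hall.congr' ?_
  filter_upwards [self_mem_nhdsWithin] with x hx
  have hx : 0 < x := hx
  have hF := (hpos x hx).ne'
  have hφ : (∫ y, Real.exp (-(1 / x * y)) ∂M) ≠ 0 := by
    rw [hLap _ (by positivity)]
    exact (Real.exp_pos _).ne'
  have hxc := (Real.rpow_pos_of_pos hx c).ne'
  rw [Real.rpow_sub_one hx.ne', ENNReal.toReal_mul, ENNReal.toReal_inv,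
    ENNReal.toReal_ofReal hx.le]
  generalize (∫ y, Real.exp (-(1 / x * y)) ∂M) = φ at hφ ⊢
  generalize (∫ y in Set.Ioc x 1, (c - k y) / y) = J
  field_simp

theorem measure_Iio_eq_zero_of_laplace {k : ℝ → ℝ} {M : Measure ℝ} [IsProbabilityMeasure M]
    (hknonneg : ∀ x > (0:ℝ), 0 ≤ k x)
    (hLap : ∀ u ≥ (0:ℝ), ∫ x, Real.exp (-(u * x)) ∂M
        = Real.exp (∫ x in Ioi (0:ℝ), (Real.exp (-(u * x)) - 1) * (k x / x))) :
    M (Iio 0) = 0 := by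
  have hle1 : ∀ u ≥ (0:ℝ), ∫ x, Real.exp (-(u * x)) ∂M ≤ 1 := by
    intro u hu
    rw [hLap u hu, Real.exp_le_one_iff]
    refine setIntegral_nonpos measurableSet_Ioi fun x hx => ?_
    have hx : 0 < x := hx
    refine mul_nonpos_of_nonpos_of_nonneg ?_ (div_nonneg (hknonneg x hx) hx.le)
    have : Real.exp (-(u * x)) ≤ 1 := Real.exp_le_one_iff.2 (by
      have : 0 ≤ u * x := by positivity
      linarith)
    linarith
  have hnull : ∀ ε > (0:ℝ), M (Iic (-ε)) = 0 := by
    intro ε hε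
    rw [← measureReal_eq_zero_iff]
    refine le_antisymm ?_ measureReal_nonneg
    have hbound : ∀ u > (0:ℝ), M.real (Iic (-ε)) ≤ Real.exp (-(u * ε)) := by
      intro u hu
      have h1 := ProbabilityTheory.measure_le_le_exp_mul_mgf (μ := M) (X := id) (t := -u) (-ε)
        (by linarith) (by simpa using integrable_exp_of_laplace hLap hu.le)
      have h2 : ProbabilityTheory.mgf id M (-u) ≤ 1 := by
        simpa [ProbabilityTheory.mgf] using hle1 u hu.le
      calc M.real (Iic (-ε)) ≤ Real.exp (-(-u) * -ε) * ProbabilityTheory.mgf id M (-u) := h1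
        _ ≤ Real.exp (-(-u) * -ε) * 1 := by gcongr
        _ = _ := by ring_nf
    refine ge_of_tendsto (Real.tendsto_exp_neg_atTop_nhds_zero.comp
      (tendsto_id.atTop_mul_const hε)) ?_
    filter_upwards [eventually_gt_atTop 0] with u hu using hbound u hu
  have hunion : Iio (0:ℝ) ⊆ ⋃ n : ℕ, Iic (-(1 / ((n : ℝ) + 1))) := by
    intro x hx
    have hx : x < 0 := hx
    obtain ⟨n, hn⟩ := exists_nat_one_div_lt (neg_pos.2 hx)
    exact mem_iUnion.2 ⟨n, by simp only [mem_Iic]; linarith⟩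
  exact measure_mono_null hunion (measure_iUnion_null fun n => hnull _ (by positivity))

/-- Let `L` be a probability measure on `[0,∞)` with Laplace transform
`∫ e^{−ux} dL(x) = exp(−γu + ∫_0^∞ (e^{−ux} − 1) k(x)/x dx)` for all `u ≥ 0`, where
`γ ≥ 0` and `k : (0,∞) → [0,∞)` is Borel with `∫_0^∞ min(1,x) k(x)/x dx < ∞`.
Suppose `c = lim_{x↓0} k(x)` exists in `(0,∞)`, and set
`K(x) = exp(∫_x^1 (c − k(y))/y dy)` and
`κ = exp(c ∫_0^1 (e^{−x} − 1)/x dx + c ∫_1^∞ e^{−x}/x dx − ∫_1^∞ k(x)/x dx)`.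
Then `L` is absolutely continuous with a density `ρ` w.r.t. Lebesgue measure, and
`ρ(γ + x) Γ(c) / (κ x^{c−1} K(x)) → 1` as `x ↓ 0`. -/
theorem stmt15 (γ : ℝ) (hγ : 0 ≤ γ) (k : ℝ → ℝ) (hkmeas : Measurable k)
    (hknonneg : ∀ x > (0:ℝ), 0 ≤ k x)
    (hkint : ∫⁻ x in Set.Ioi (0:ℝ), ENNReal.ofReal (min 1 x * (k x / x)) < ⊤)
    (L : Measure ℝ) [IsProbabilityMeasure L] (hLsupp : L (Set.Iio 0) = 0)
    (hLap : ∀ u ≥ (0:ℝ),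
      ∫ x, Real.exp (-(u * x)) ∂L
        = Real.exp (-(γ * u) +
            ∫ x in Set.Ioi (0:ℝ), (Real.exp (-(u * x)) - 1) * (k x / x)))
    (c : ℝ) (hc : 0 < c) (hlim : Tendsto k (𝓝[>] (0:ℝ)) (𝓝 c))
    (K : ℝ → ℝ)
    (hK : ∀ x, K x = Real.exp (∫ y in Set.Ioc x 1, (c - k y) / y))
    (κ : ℝ)
    (hκ : κ = Real.exp (c * (∫ x in Set.Ioc (0:ℝ) 1, (Real.exp (-x) - 1) / x)
        + c * (∫ x in Set.Ioi (1:ℝ), Real.exp (-x) / x)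
        - ∫ x in Set.Ioi (1:ℝ), k x / x)) :
    ∃ ρ : ℝ → ℝ, Measurable ρ ∧ (∀ x, 0 ≤ ρ x) ∧
      L = MeasureTheory.volume.withDensity (fun x => ENNReal.ofReal (ρ x)) ∧
      Tendsto (fun x => ρ (γ + x) * Real.Gamma c / (κ * x ^ (c - 1) * K x))
        (𝓝[>] (0:ℝ)) (𝓝 1) := by
  have hI : IntegrableOn (fun x => min 1 x * (k x / x)) (Ioi 0) := by
    refine ⟨by fun_prop, ?_⟩
    rw [hasFiniteIntegral_iff_ofReal]
    · exact hkint
    · refine (ae_restrict_iff' measurableSet_Ioi).2 (ae_of_all _ fun x hx => ?_)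
      have hx : 0 < x := hx
      exact mul_nonneg (le_min zero_le_one hx.le) (div_nonneg (hknonneg x hx) hx.le)
  set M : Measure ℝ := L.map (fun x => x - γ) with hMdef
  have hmeas : Measurable fun x : ℝ => x - γ := by fun_prop
  have : IsProbabilityMeasure M := Measure.isProbabilityMeasure_map hmeas.aemeasurable
  have hLapM : ∀ u ≥ (0:ℝ), ∫ x, Real.exp (-(u * x)) ∂M
      = Real.exp (∫ x in Ioi (0:ℝ), (Real.exp (-(u * x)) - 1) * (k x / x)) := by
    intro u hu
    rw [hMdef, integral_map hmeas.aemeasurable (by fun_prop)]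
    have h1 : ∀ x : ℝ, Real.exp (-(u * (x - γ))) = Real.exp (γ * u) * Real.exp (-(u * x)) := by
      intro x
      rw [← Real.exp_add]
      ring_nf
    simp only [h1]
    rw [integral_const_mul, hLap u hu, ← Real.exp_add]
    congr 1
    ring
  have hM := measure_Iio_eq_zero_of_laplace hknonneg hLapM
  have hdens := eq_withDensity hkmeas (withDensity_id_eq hkmeas hknonneg hI hM hLapM) hM hc hlim
  set h : ℝ → ℝ≥0∞ := fun z => sizeBiasDensity k M z * (ENNReal.ofReal z)⁻¹ with hh
  have hhm : Measurable h :=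
    (measurable_sizeBiasDensity hkmeas M).mul (by fun_prop)
  have hfin : ∀ᵐ z, h z < ⊤ := by
    refine ae_lt_top hhm ?_
    rw [← setLIntegral_univ, ← withDensity_apply _ MeasurableSet.univ, ← hdens]
    exact measure_ne_top _ _
  have hdens' : M = volume.withDensity fun z => ENNReal.ofReal (h z).toReal := by
    conv_lhs => rw [hdens]
    refine withDensity_congr_ae ?_
    filter_upwards [hfin] with z hz
    rw [ENNReal.ofReal_toReal hz.ne]
  refine ⟨fun x => (h (x - γ)).toReal, (hhm.comp hmeas).ennreal_toReal,
    fun x => ENNReal.toReal_nonneg, ?_, ?_⟩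
  · ext s hs
    have hpre : MeasurableSet ((fun x : ℝ => x + γ) ⁻¹' s) := (measurable_add_const γ) hs
    have h1 : L s = M ((fun x : ℝ => x + γ) ⁻¹' s) := by
      rw [hMdef, Measure.map_apply hmeas hpre, ← preimage_comp]
      simp [Function.comp_def]
    have h2 := (measurePreserving_add_right volume γ).setLIntegral_comp_preimage hs
      (f := fun x => ENNReal.ofReal (h (x - γ)).toReal)
      (hhm.comp hmeas).ennreal_toReal.ennreal_ofReal
    simp only [add_sub_cancel_right] at h2
    rw [h1, hdens', withDensity_apply _ hpre, withDensity_apply _ hs]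
    exact h2
  · have hfinal := tendsto_density_of_laplace hkmeas hknonneg hI hM hLapM hc hlim hdens
    rw [← hκ] at hfinal
    simpa only [add_sub_cancel_left, hK] using hfinal
end

section
/- Let R : [0,∞) → ℝ be continuous with R(0) = 0 and R(s) < 0 for all s > 0, and assume ∫_0^ε ds/(−R(s)) = ∞ for some ε > 0. Fix u > 0 and let ψ : [0,∞) → [0,∞) be differentiable with ψ(0) = u and ψ′(t) = R(ψ(t)) for all t ≥ 0. Then ψ(t) > 0 for all t, ψ is strictly decreasing, ψ(t) → 0 as t → ∞, and for every continuous F : [0,∞) → [0,∞) and every t ≥ 0 one has ∫_0^t F(ψ(r)) dr = ∫_{ψ(t)}^{u} F(s)/(−R(s)) ds; consequently ∫_0^∞ F(ψ(r)) dr = ∫_0^u F(s)/(−R(s)) ds as an equality in [0, +∞]. -/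
open MeasureTheory Filter Set
open scoped ENNReal Topology

/-- The reciprocal of a continuous negative function is integrable away from the origin. -/
lemma setLIntegral_one_div_neg_lt_top {R : ℝ → ℝ} (hRcont : ContinuousOn R (Ici 0))
    (hRneg : ∀ s > (0 : ℝ), R s < 0) {a b : ℝ} (ha : 0 < a) :
    ∫⁻ s in Icc a b, ENNReal.ofReal (1 / (-R s)) < ⊤ := by
  refine (ContinuousOn.integrableOn_Icc ?_).setLIntegral_lt_top
  refine continuousOn_const.div ((hRcont.mono fun x hx => ha.le.trans hx.1).neg) fun x hx => ?_
  exact (neg_pos.2 (hRneg x (ha.trans_le hx.1))).ne'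

section Autonomous

variable {R ψ : ℝ → ℝ}

lemma antitoneOn_of_autonomous (hR0 : R 0 = 0) (hRneg : ∀ s > (0 : ℝ), R s < 0)
    (hψnonneg : ∀ t ≥ (0 : ℝ), 0 ≤ ψ t)
    (hψ' : ∀ t ≥ (0 : ℝ), HasDerivWithinAt ψ (R (ψ t)) (Ici 0) t) :
    AntitoneOn ψ (Ici 0) := by
  have hd (t : ℝ) (ht : t ∈ interior (Ici (0 : ℝ))) : HasDerivAt ψ (R (ψ t)) t := by
    rw [interior_Ici] at ht
    exact (hψ' t (le_of_lt ht)).hasDerivAt (Ici_mem_nhds ht)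
  refine antitoneOn_of_deriv_nonpos (convex_Ici 0)
    (fun t ht => (hψ' t ht).continuousWithinAt)
    (fun t ht => (hd t ht).differentiableAt.differentiableWithinAt) fun t ht => ?_
  rw [(hd t ht).deriv]
  rcases (hψnonneg t (interior_subset ht)).eq_or_lt with h | h
  · rw [← h, hR0]
  · exact (hRneg _ h).le

lemma strictAntiOn_of_autonomous (hRneg : ∀ s > (0 : ℝ), R s < 0)
    (hψpos : ∀ t ≥ (0 : ℝ), 0 < ψ t)
    (hψ' : ∀ t ≥ (0 : ℝ), HasDerivWithinAt ψ (R (ψ t)) (Ici 0) t) :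
    StrictAntiOn ψ (Ici 0) := by
  refine strictAntiOn_of_deriv_neg (convex_Ici 0)
    (fun t ht => (hψ' t ht).continuousWithinAt) fun t ht => ?_
  rw [interior_Ici] at ht
  rw [((hψ' t (le_of_lt ht)).hasDerivAt (Ici_mem_nhds ht)).deriv]
  exact hRneg _ (hψpos t (le_of_lt ht))

/-- A solution of `ψ' = R(ψ)` does not reach `0` in finite time when `1 / (-R)` is not
integrable at `0`. -/
lemma pos_of_autonomous (hRcont : ContinuousOn R (Ici 0)) (hR0 : R 0 = 0)
    (hRneg : ∀ s > (0 : ℝ), R s < 0)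
    (hdiv : ∃ ε > (0 : ℝ), ∫⁻ s in Ioo (0 : ℝ) ε, ENNReal.ofReal (1 / (-R s)) = ⊤)
    (hψ0 : 0 < ψ 0) (hψnonneg : ∀ t ≥ (0 : ℝ), 0 ≤ ψ t)
    (hψ' : ∀ t ≥ (0 : ℝ), HasDerivWithinAt ψ (R (ψ t)) (Ici 0) t) {t : ℝ} (ht : 0 ≤ t) :
    0 < ψ t := by
  by_contra hneg
  have hzero : ψ t = 0 := le_antisymm (not_lt.1 hneg) (hψnonneg t ht)
  obtain ⟨ε, -, hε⟩ := hdiv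
  have hsub : Ioo 0 t ⊆ Ici (0 : ℝ) := fun x hx => hx.1.le
  have hivt : Ioo 0 (ψ 0) ⊆ ψ '' Ioo 0 t := by
    have h := intermediate_value_Ioo' ht fun x hx =>
      ((hψ' x hx.1).mono Icc_subset_Ici_self).continuousWithinAt
    rwa [hzero] at h
  have hcover : Ioo 0 ε ⊆ ψ '' Ioo 0 t ∪ Icc (ψ 0) ε := fun x hx => by
    rcases lt_or_ge x (ψ 0) with h | h
    · exact Or.inl (hivt ⟨hx.1, h⟩)
    · exact Or.inr ⟨h, hx.2.le⟩
  have himage : ∫⁻ s in ψ '' Ioo 0 t, ENNReal.ofReal (1 / (-R s)) < ⊤ := by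
    rw [lintegral_image_eq_lintegral_deriv_mul_of_antitoneOn measurableSet_Ioo
      (fun x hx => (hψ' x hx.1.le).mono hsub)
      ((antitoneOn_of_autonomous hR0 hRneg hψnonneg hψ').mono hsub)]
    calc ∫⁻ x in Ioo 0 t, ENNReal.ofReal (-R (ψ x)) * ENNReal.ofReal (1 / (-R (ψ x)))
        ≤ ∫⁻ _ in Ioo 0 t, 1 := by
          refine lintegral_mono fun x => ?_
          rcases le_or_gt (-R (ψ x)) 0 with h | h
          · simp [ENNReal.ofReal_of_nonpos h]
          · rw [← ENNReal.ofReal_mul h.le, mul_one_div_cancel h.ne', ENNReal.ofReal_one]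
      _ < ⊤ := by simp
  refine (ENNReal.add_lt_top.2
    ⟨himage, setLIntegral_one_div_neg_lt_top hRcont hRneg (b := ε) hψ0⟩).ne ?_
  rw [eq_top_iff, ← hε]
  exact (lintegral_mono_set hcover).trans (lintegral_union_le _ _ _)

lemma image_Ioo_of_autonomous (hψ : StrictAntiOn ψ (Ici 0)) (hcont : ContinuousOn ψ (Ici 0))
    {t : ℝ} (ht : 0 ≤ t) : ψ '' Ioo 0 t = Ioo (ψ t) (ψ 0) := by
  refine Subset.antisymm ?_ (intermediate_value_Ioo' ht (hcont.mono Icc_subset_Ici_self))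
  rintro _ ⟨x, hx, rfl⟩
  exact ⟨hψ hx.1.le ht hx.2, hψ self_mem_Ici hx.1.le hx.1⟩

/-- Change of variables `s = ψ(r)` for the lower Lebesgue integral. -/
lemma setLIntegral_comp_of_autonomous (hRneg : ∀ s > (0 : ℝ), R s < 0)
    (hψpos : ∀ t ≥ (0 : ℝ), 0 < ψ t)
    (hψ' : ∀ t ≥ (0 : ℝ), HasDerivWithinAt ψ (R (ψ t)) (Ici 0) t)
    {S : Set ℝ} (hS : MeasurableSet S) (hS0 : S ⊆ Ici 0) (F : ℝ → ℝ) :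
    ∫⁻ r in S, ENNReal.ofReal (F (ψ r))
      = ∫⁻ s in ψ '' S, ENNReal.ofReal (F s / (-R s)) := by
  rw [lintegral_image_eq_lintegral_deriv_mul_of_antitoneOn hS
    (fun x hx => (hψ' x (hS0 hx)).mono hS0)
    ((strictAntiOn_of_autonomous hRneg hψpos hψ').antitoneOn.mono hS0)]
  refine setLIntegral_congr_fun hS fun x hx => ?_
  have h : 0 < -R (ψ x) := neg_pos.2 (hRneg _ (hψpos x (hS0 hx)))
  simp only [mul_div_cancel₀ _ h.ne', ← ENNReal.ofReal_mul h.le]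

/-- Change of variables `s = ψ(r)` for the Bochner integral. -/
lemma setIntegral_comp_of_autonomous (hRneg : ∀ s > (0 : ℝ), R s < 0)
    (hψpos : ∀ t ≥ (0 : ℝ), 0 < ψ t)
    (hψ' : ∀ t ≥ (0 : ℝ), HasDerivWithinAt ψ (R (ψ t)) (Ici 0) t)
    {S : Set ℝ} (hS : MeasurableSet S) (hS0 : S ⊆ Ici 0) (F : ℝ → ℝ) :
    ∫ r in S, F (ψ r) = ∫ s in ψ '' S, F s / (-R s) := by
  rw [integral_image_eq_integral_deriv_smul_of_antitoneOn hS
    (fun x hx => (hψ' x (hS0 hx)).mono hS0)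
    ((strictAntiOn_of_autonomous hRneg hψpos hψ').antitoneOn.mono hS0)]
  refine setIntegral_congr_fun hS fun x hx => ?_
  have h : 0 < -R (ψ x) := neg_pos.2 (hRneg _ (hψpos x (hS0 hx)))
  simp only [smul_eq_mul, mul_div_cancel₀ _ h.ne']

lemma tendsto_zero_of_autonomous (hRcont : ContinuousOn R (Ici 0))
    (hRneg : ∀ s > (0 : ℝ), R s < 0) (hψpos : ∀ t ≥ (0 : ℝ), 0 < ψ t)
    (hψ' : ∀ t ≥ (0 : ℝ), HasDerivWithinAt ψ (R (ψ t)) (Ici 0) t) :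
    Tendsto ψ atTop (𝓝 0) := by
  have hanti := strictAntiOn_of_autonomous hRneg hψpos hψ'
  have hsmall (δ : ℝ) (hδ : 0 < δ) : ∃ t ≥ (0 : ℝ), ψ t < δ := by
    by_contra! hbelow
    have hfin := setLIntegral_one_div_neg_lt_top hRcont hRneg (b := ψ 0) hδ
    have hvol : volume (Ioi (0 : ℝ)) ≤ ∫⁻ s in Icc δ (ψ 0), ENNReal.ofReal (1 / (-R s)) := by
      calc volume (Ioi (0 : ℝ)) = ∫⁻ _ in Ioi (0 : ℝ), ENNReal.ofReal 1 := by simp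
        _ = ∫⁻ s in ψ '' Ioi 0, ENNReal.ofReal (1 / (-R s)) :=
          setLIntegral_comp_of_autonomous hRneg hψpos hψ' measurableSet_Ioi
            Ioi_subset_Ici_self fun _ => 1
        _ ≤ _ := by
          refine lintegral_mono_set ?_
          rintro _ ⟨x, hx, rfl⟩
          exact ⟨hbelow x (le_of_lt hx),
            hanti.antitoneOn self_mem_Ici (Ioi_subset_Ici_self hx) (le_of_lt hx)⟩
    rw [Real.volume_Ioi] at hvol
    exact (hvol.trans_lt hfin).ne rfl
  refine tendsto_order.2 ⟨fun a ha => ?_, fun a ha => ?_⟩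
  · filter_upwards [eventually_ge_atTop 0] with t ht using ha.trans (hψpos t ht)
  · obtain ⟨t₀, ht₀, hlt⟩ := hsmall a ha
    filter_upwards [eventually_ge_atTop t₀] with t ht
    exact (hanti.antitoneOn ht₀ (ht₀.trans ht) ht).trans_lt hlt

lemma image_Ioi_of_autonomous (hψ : StrictAntiOn ψ (Ici 0)) (hcont : ContinuousOn ψ (Ici 0))
    (hψpos : ∀ t ≥ (0 : ℝ), 0 < ψ t) (hlim : Tendsto ψ atTop (𝓝 0)) :
    ψ '' Ioi 0 = Ioo 0 (ψ 0) := by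
  refine Subset.antisymm ?_ fun y hy => ?_
  · rintro _ ⟨x, hx, rfl⟩
    exact ⟨hψpos x (le_of_lt hx), hψ self_mem_Ici (Ioi_subset_Ici_self hx) hx⟩
  · obtain ⟨t, hty, ht⟩ := ((hlim.eventually_lt_const hy.1).and (eventually_ge_atTop 0)).exists
    refine image_mono (Ioo_subset_Ioi_self : Ioo 0 t ⊆ Ioi 0) ?_
    rw [image_Ioo_of_autonomous hψ hcont ht]
    exact ⟨hty, hy.2⟩

end Autonomous

/-- Let `R : [0,∞) → ℝ` be continuous with `R(0) = 0`, `R < 0` on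
`(0,∞)` and `∫_0^ε ds/(−R(s)) = ∞` for some `ε > 0`.  Fix `u > 0` and let
`ψ : [0,∞) → [0,∞)` solve `ψ(0) = u`, `ψ′(t) = R(ψ(t))`.  Then `ψ > 0`, `ψ` is strictly
decreasing, `ψ(t) → 0` as `t → ∞`, and for every continuous `F : [0,∞) → [0,∞)` and
`t ≥ 0`,
`∫_0^t F(ψ(r)) dr = ∫_{ψ(t)}^u F(s)/(−R(s)) ds`; consequently
`∫_0^∞ F(ψ(r)) dr = ∫_0^u F(s)/(−R(s)) ds` in `[0,∞]`. -/
theorem stmt16 (R : ℝ → ℝ) (hRcont : ContinuousOn R (Set.Ici 0)) (hR0 : R 0 = 0)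
    (hRneg : ∀ s > (0:ℝ), R s < 0)
    (hdiv : ∃ ε > (0:ℝ),
      ∫⁻ s in Set.Ioo (0:ℝ) ε, ENNReal.ofReal (1 / (-R s)) = ⊤)
    (u : ℝ) (hu : 0 < u)
    (ψ : ℝ → ℝ) (hψ0 : ψ 0 = u) (hψnonneg : ∀ t ≥ (0:ℝ), 0 ≤ ψ t)
    (hψ' : ∀ t ≥ (0:ℝ), HasDerivWithinAt ψ (R (ψ t)) (Set.Ici 0) t) :
    (∀ t ≥ (0:ℝ), 0 < ψ t) ∧
    StrictAntiOn ψ (Set.Ici 0) ∧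
    Tendsto ψ atTop (𝓝 0) ∧
    ∀ F : ℝ → ℝ, ContinuousOn F (Set.Ici 0) → (∀ s ≥ (0:ℝ), 0 ≤ F s) →
      (∀ t ≥ (0:ℝ),
        ∫ r in Set.Ioo (0:ℝ) t, F (ψ r)
          = ∫ s in Set.Ioo (ψ t) u, F s / (-R s)) ∧
      ∫⁻ r in Set.Ioi (0:ℝ), ENNReal.ofReal (F (ψ r))
        = ∫⁻ s in Set.Ioo (0:ℝ) u, ENNReal.ofReal (F s / (-R s)) := by
  subst hψ0
  have hpos : ∀ t ≥ (0 : ℝ), 0 < ψ t := fun t ht =>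
    pos_of_autonomous hRcont hR0 hRneg hdiv hu hψnonneg hψ' ht
  have hanti := strictAntiOn_of_autonomous hRneg hpos hψ'
  have hcont : ContinuousOn ψ (Ici 0) := fun t ht => (hψ' t ht).continuousWithinAt
  have hlim := tendsto_zero_of_autonomous hRcont hRneg hpos hψ'
  refine ⟨hpos, hanti, hlim, fun F _ _ => ⟨fun t ht => ?_, ?_⟩⟩
  · rw [setIntegral_comp_of_autonomous hRneg hpos hψ' measurableSet_Ioo
      (Ioo_subset_Ioi_self.trans Ioi_subset_Ici_self), image_Ioo_of_autonomous hanti hcont ht]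
  · rw [setLIntegral_comp_of_autonomous hRneg hpos hψ' measurableSet_Ioi Ioi_subset_Ici_self,
      image_Ioi_of_autonomous hanti hcont hpos hlim]
end

section
/- Let W(x) = 1 − e^{−2x} for x ≥ 0 and W(x) = 0 for x < 0 (the scale function for R(u) = −u²/2 − u), and let m be the measure on (0,∞) with density e^{−ξ} with respect to Lebesgue measure. Then the function k(x) = ∫_(0,∞) (W(x) − W(x−ξ)) m(dξ) satisfies k(x) = 2·(e^{−x} − e^{−2x}) for every x > 0, and k is not monotone nonincreasing on (0,∞). -/
open MeasureTheory Filter Set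
open scoped ENNReal Topology

theorem integral_scale_increment (W : ℝ → ℝ)
    (hW : ∀ x, W x = if 0 ≤ x then 1 - Real.exp (-2 * x) else 0) {x : ℝ} (hx : 0 < x) :
    ∫ ξ in Set.Ioi (0:ℝ), (W x - W (x - ξ)) * Real.exp (-ξ) =
      2 * (Real.exp (-x) - Real.exp (-2 * x)) := by
  have below : Set.EqOn (fun ξ => (W x - W (x - ξ)) * Real.exp (-ξ))
      (fun ξ => Real.exp (-2 * x) * (Real.exp ξ - Real.exp (-ξ))) (Set.Ioc 0 x) := by
    intro ξ hξ
    have hexp : Real.exp (-2 * (x - ξ)) * Real.exp (-ξ) = Real.exp (-2 * x) * Real.exp ξ := by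
      rw [← Real.exp_add, ← Real.exp_add]
      ring_nf
    simp only [hW, if_pos hx.le, if_pos (sub_nonneg.2 hξ.2)]
    linear_combination hexp
  have above : Set.EqOn (fun ξ => (W x - W (x - ξ)) * Real.exp (-ξ))
      (fun ξ => (1 - Real.exp (-2 * x)) * Real.exp (-ξ)) (Set.Ioi x) := by
    intro ξ hξ
    have hneg : ¬ 0 ≤ x - ξ := not_le.2 (sub_neg.2 hξ)
    simp only [hW, if_pos hx.le, if_neg hneg, sub_zero]
  have hbelow : IntegrableOn (fun ξ => Real.exp (-2 * x) * (Real.exp ξ - Real.exp (-ξ)))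
      (Set.Ioc 0 x) :=
    (Continuous.integrableOn_Icc (by fun_prop)).mono_set Set.Ioc_subset_Icc_self
  have habove : IntegrableOn (fun ξ => (1 - Real.exp (-2 * x)) * Real.exp (-ξ)) (Set.Ioi x) :=
    (integrableOn_exp_neg_Ioi x).const_mul _
  have hsinh : ∫ ξ in (0:ℝ)..x, (Real.exp ξ - Real.exp (-ξ)) =
      Real.exp x + Real.exp (-x) - 2 := by
    rw [intervalIntegral.integral_eq_sub_of_hasDerivAt
      (f := fun ξ => Real.exp ξ + Real.exp (-ξ))]
    · norm_num
    · intro ξ _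
      exact ((Real.hasDerivAt_exp ξ).add (hasDerivAt_neg ξ).exp).congr_deriv (by ring)
    · exact Continuous.intervalIntegrable (by fun_prop) _ _
  rw [← Set.Ioc_union_Ioi_eq_Ioi hx.le, setIntegral_union Set.Ioc_disjoint_Ioi_same
    measurableSet_Ioi (hbelow.congr_fun below.symm measurableSet_Ioc)
    (habove.congr_fun above.symm measurableSet_Ioi),
    setIntegral_congr_fun measurableSet_Ioc below, setIntegral_congr_fun measurableSet_Ioi above,
    integral_const_mul, integral_const_mul, integral_exp_neg_Ioi,
    ← intervalIntegral.integral_of_le hx.le, hsinh]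
  have hsq : Real.exp (-2 * x) = Real.exp (-x) ^ 2 := by
    rw [← Real.exp_nat_mul]
    push_cast
    ring_nf
  have hinv : Real.exp (-x) * Real.exp x = 1 := by simp [← Real.exp_add]
  rw [hsq]
  linear_combination Real.exp (-x) * hinv

theorem not_antitoneOn_exp_sub_exp :
    ¬ AntitoneOn (fun x : ℝ => 2 * (Real.exp (-x) - Real.exp (-2 * x))) (Set.Ioi 0) := by
  intro h
  have value {a : ℝ} (ha : 0 < a) :
      2 * (Real.exp (-Real.log a) - Real.exp (-2 * Real.log a)) = 2 * (a⁻¹ - a⁻¹ ^ 2) := by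
    have hsq : Real.exp (-2 * Real.log a) = Real.exp (-Real.log a) ^ 2 := by
      rw [← Real.exp_nat_mul]
      push_cast
      ring_nf
    rw [hsq, Real.exp_neg, Real.exp_log ha]
  have hle := h (a := Real.log (4 / 3)) (b := Real.log 2) (Real.log_pos (by norm_num))
    (Real.log_pos (by norm_num)) (Real.log_le_log (by norm_num) (by norm_num))
  simp only at hle
  rw [value (by norm_num), value (by norm_num)] at hle
  norm_num at hle

/-- Let `W(x) = 1 − e^{−2x}` for `x ≥ 0` and `W(x) = 0` for `x < 0`
(the scale function for `R(u) = −u²/2 − u`), and let `m(dξ) = e^{−ξ} dξ` on `(0,∞)`.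
Then `k(x) = ∫_(0,∞) (W(x) − W(x−ξ)) m(dξ)` equals `2(e^{−x} − e^{−2x})` for every
`x > 0`, and `k` is not monotone nonincreasing on `(0,∞)`. -/
theorem stmt18 (W : ℝ → ℝ)
    (hW : ∀ x, W x = if 0 ≤ x then 1 - Real.exp (-2 * x) else 0)
    (k : ℝ → ℝ)
    (hk : ∀ x, k x = ∫ ξ in Set.Ioi (0:ℝ), (W x - W (x - ξ)) * Real.exp (-ξ)) :
    (∀ x > (0:ℝ), k x = 2 * (Real.exp (-x) - Real.exp (-2 * x))) ∧
    ¬ AntitoneOn k (Set.Ioi 0) := by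
  have hformula : ∀ x > (0:ℝ), k x = 2 * (Real.exp (-x) - Real.exp (-2 * x)) :=
    fun x hx => (hk x).trans (integral_scale_increment W hW hx)
  exact ⟨hformula, fun h => not_antitoneOn_exp_sub_exp (h.congr hformula)⟩
end

section
/- Let b ≥ 0, let m be a Borel measure on (0,∞) with ∫_(0,∞) min(ξ,1) m(dξ) < ∞, and let W : (0,∞) → (0,∞) be nondecreasing such that log W is concave on (0,∞) (hence W has a right derivative W′₊ everywhere on (0,∞)). Define k(x) = b·W′₊(x) + ∫_(0,∞) (W(x) − W(x−ξ)) m(dξ) for x > 0, where W(x−ξ) is understood as 0 when x − ξ ≤ 0. If there exists a sequence xᵢ ↓ 0 with k(xᵢ) = 0 for all i, then m is the zero measure, either b = 0 or W is constant on (0,∞), and consequently k(x) = 0 for every x > 0. -/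
open MeasureTheory Filter Set
open scoped ENNReal Topology

/-- Let `b ≥ 0`, let `m` be a Borel measure on `(0,∞)` with
`∫ min(ξ,1) m(dξ) < ∞`, and let `W : (0,∞) → (0,∞)` be nondecreasing and log-concave
(with right derivative `W′₊`), extended by `0` on `(−∞,0]`.  Define
`k(x) = b W′₊(x) + ∫_(0,∞) (W(x) − W(x−ξ)) m(dξ)` for `x > 0`.  If there is a sequence
`xᵢ ↓ 0` with `k(xᵢ) = 0` for all `i`, then `m = 0`, either `b = 0` or `W` is constant
on `(0,∞)`, and consequently `k(x) = 0` for all `x > 0`. -/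
theorem stmt19 (b : ℝ) (hb : 0 ≤ b) (m : Measure ℝ)
    (hmsupp : m (Set.Iic 0) = 0)
    (hm : ∫⁻ ξ in Set.Ioi (0:ℝ), ENNReal.ofReal (min ξ 1) ∂m < ⊤)
    (W : ℝ → ℝ) (hWpos : ∀ x > (0:ℝ), 0 < W x) (hWzero : ∀ x ≤ (0:ℝ), W x = 0)
    (hWmono : MonotoneOn W (Set.Ioi 0))
    (hWlogconc : ConcaveOn ℝ (Set.Ioi 0) (fun x => Real.log (W x)))
    (W' : ℝ → ℝ)
    (hW' : ∀ x > (0:ℝ), HasDerivWithinAt W (W' x) (Set.Ici x) x)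
    (k : ℝ → ℝ≥0∞)
    (hk : ∀ x, k x = ENNReal.ofReal (b * W' x)
      + ∫⁻ ξ in Set.Ioi (0:ℝ), ENNReal.ofReal (W x - W (x - ξ)) ∂m)
    (x : ℕ → ℝ) (hxpos : ∀ i, 0 < x i) (hxanti : Antitone x)
    (hxlim : Tendsto x atTop (𝓝 0))
    (hkx : ∀ i, k (x i) = 0) :
    m = 0 ∧ (b = 0 ∨ ∀ y > (0:ℝ), ∀ z > (0:ℝ), W y = W z) ∧ ∀ y > (0:ℝ), k y = 0 := by
  have hexists : ∀ y > (0:ℝ), ∃ i, x i < y := fun y hy =>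
    (hxlim.eventually (gt_mem_nhds hy)).exists
  have hzero : ∀ i, ENNReal.ofReal (b * W' (x i)) = 0 ∧
      ∫⁻ ξ in Ioi (0:ℝ), ENNReal.ofReal (W (x i) - W (x i - ξ)) ∂m = 0 := fun i => by
    have h := hkx i
    rwa [hk, add_eq_zero] at h
  have hIci : ∀ i, m (Ici (x i)) = 0 := fun i => by
    have hle : ENNReal.ofReal (W (x i)) * m (Ici (x i)) ≤ 0 := by
      rw [← setLIntegral_const, ← (hzero i).2]
      calc ∫⁻ _ in Ici (x i), ENNReal.ofReal (W (x i)) ∂m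
          = ∫⁻ ξ in Ici (x i), ENNReal.ofReal (W (x i) - W (x i - ξ)) ∂m := by
            refine setLIntegral_congr_fun measurableSet_Ici fun ξ hξ => ?_
            simp only [hWzero (x i - ξ) (sub_nonpos.2 hξ), sub_zero]
        _ ≤ _ := lintegral_mono_set (Ici_subset_Ioi.2 (hxpos i))
    have h0 := mul_eq_zero.1 (nonpos_iff_eq_zero.1 hle)
    exact h0.resolve_left (ENNReal.ofReal_pos.2 (hWpos _ (hxpos i))).ne'
  have hm0 : m = 0 := by
    rw [← Measure.measure_univ_eq_zero]
    refine measure_mono_null (t := Iic 0 ∪ ⋃ i, Ici (x i)) (fun y _ => ?_)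
      (measure_union_null hmsupp (measure_iUnion_null hIci))
    rcases le_or_gt y 0 with hy | hy
    · exact Or.inl hy
    · obtain ⟨i, hi⟩ := hexists y hy
      exact Or.inr (mem_iUnion.2 ⟨i, hi.le⟩)
  have hconst : b = 0 ∨ ∀ y > (0:ℝ), ∀ z > (0:ℝ), W y = W z := by
    refine or_iff_not_imp_left.2 fun hb0 => ?_
    have heq : ∀ i, ∀ y, x i < y → W y = W (x i) := fun i y hy => by
      have hypos := (hxpos i).trans hy
      have hW'le : W' (x i) ≤ 0 :=
        nonpos_of_mul_nonpos_right (ENNReal.ofReal_eq_zero.1 (hzero i).1) (hb.lt_of_ne' hb0)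
      have hWi := hWpos _ (hxpos i)
      have hd := ((hW' _ (hxpos i)).log hWi.ne').mono Ioi_subset_Ici_self
      have hs := (hWlogconc.slope_le_of_hasDerivWithinAt_Ioi (hxpos i) hypos hy hd).trans
        (div_nonpos_of_nonpos_of_nonneg hW'le hWi.le)
      rw [slope_def_field, div_le_iff₀ (sub_pos.2 hy), zero_mul, sub_nonpos] at hs
      exact le_antisymm ((Real.log_le_log_iff (hWpos _ hypos) hWi).1 hs)
        (hWmono (hxpos i) hypos hy.le)
    intro y hy z hz
    obtain ⟨i, hi⟩ := hexists _ (lt_min hy hz)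
    rw [heq i y (hi.trans_le (min_le_left _ _)), heq i z (hi.trans_le (min_le_right _ _))]
  refine ⟨hm0, hconst, fun y hy => ?_⟩
  rw [hk, hm0]
  rcases hconst with rfl | hc
  · simp
  · have hd : HasDerivWithinAt W 0 (Ici y) y :=
      (hasDerivWithinAt_const y (Ici y) (W y)).congr
        (fun z hz => hc z (hy.trans_le hz) y hy) rfl
    rw [(uniqueDiffOn_Ici y y self_mem_Ici).eq_deriv _ (hW' y hy) hd]
    simp
end
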